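/- arXiv:2303.11704 — 2 statements merged into one kernel-verified Lean document; each statement's English description precedes it below -/
import Mathlib

section
/- If ω ∈ A_p^∞(φ) with 1 < p < ∞, then there exists ε with 0 < ε < p − 1 such that ω ∈ A_{p−ε}^∞(φ). Consequently, A_p^∞(φ) = ∪_{1≤q<p} A_q^∞(φ). -/
open MeasureTheory ENNReal Set Filter

noncomputable section

/-- `ℝⁿ` with the Euclidean norm. -/
abbrev En (n : ℕ) := EuclideanSpace ℝ (Fin n)

/-- The (closed) cube centered at `x` with sidelength `r`. -/
def cube {n : ℕ} (x : En n) (r : ℝ) : Set (En n) :=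
  {y | ∀ i, |y i - x i| ≤ r / 2}

/-- Weighted `L^p` norm `(∫ |f|^p w)^{1/p}` (valued in `ℝ≥0∞`). -/
def wLp {n : ℕ} (p : ℝ) (w f : En n → ℝ) : ℝ≥0∞ :=
  (∫⁻ x, ENNReal.ofReal (|f x| ^ p * w x)) ^ (1 / p)

/-- Weighted weak `L^p` norm `sup_{t>0} t · w({|f|>t})^{1/p}`. -/
def wLpWeak {n : ℕ} (p : ℝ) (w f : En n → ℝ) : ℝ≥0∞ :=
  ⨆ (t : ℝ) (_ : 0 < t), ENNReal.ofReal t *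
    (∫⁻ x in {x | t < |f x|}, ENNReal.ofReal (w x)) ^ (1 / p)

/-- The dilated kernel `K_t(x,y⃗) = t^{-mn} K(x/t, y⃗/t)`. -/
def Kt {n m : ℕ} (K : En n → (Fin m → En n) → ℝ) (t : ℝ) (x : En n)
    (y : Fin m → En n) : ℝ :=
  t ^ (-(m * n : ℝ)) * K (t⁻¹ • x) fun j => t⁻¹ • y j

/-- The multilinear square function associated with the kernel `K`. -/
def sqOp {n m : ℕ} (K : En n → (Fin m → En n) → ℝ) (f : Fin m → En n → ℝ)
    (x : En n) : ℝ :=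
  (∫ t in Ioi (0 : ℝ),
      (∫ y : Fin m → En n, Kt K t x y * ∏ j, f j (y j)) ^ 2 / t) ^ (1 / 2 : ℝ)

/-- Size condition (1.2). -/
def SizeCond (n m : ℕ) (K : En n → (Fin m → En n) → ℝ) : Prop :=
  ∀ N : ℝ, 0 ≤ N → ∃ C > 0, ∀ (y0 : En n) (y : Fin m → En n),
    0 < ∑ j, dist y0 (y j) →
    (∫ t in Ioi (0 : ℝ), (Kt K t y0 y) ^ 2 / t) ^ (1 / 2 : ℝ) ≤
      C * (∑ j, dist y0 (y j)) ^ (-(m * n : ℝ)) *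
        (1 + ∑ j, dist y0 (y j)) ^ (-N)

/-- The cube `Δ_k = Q(y₀, 2^k √(mn) |y₀ - y₀'|)`. -/
def deltaCube {n : ℕ} (m : ℕ) (y0 y0' : En n) (k : ℕ) : Set (En n) :=
  cube y0 (2 ^ k * Real.sqrt (m * n) * dist y0 y0')

/-- The "annulus" `(Δ_{k+2})^m \ (Δ_{k+1})^m`. -/
def annulus {n : ℕ} (m : ℕ) (y0 y0' : En n) (k : ℕ) : Set (Fin m → En n) :=
  {y | ∀ j, y j ∈ deltaCube m y0 y0' (k + 2)} \
    {y | ∀ j, y j ∈ deltaCube m y0 y0' (k + 1)}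

/-- Generalized smoothness condition (1.4) with constants `Ck`. -/
def GenSmoothCond (n m : ℕ) (q q' : ℝ) (Ck : ℕ → ℝ)
    (K : En n → (Fin m → En n) → ℝ) : Prop :=
  ∀ N : ℝ, 0 ≤ N → ∃ C > 0, ∀ (k : ℕ) (y0 y0' : En n), y0 ≠ y0' →
    (∫ t in Ioi (0 : ℝ),
        (∫ y in annulus m y0 y0' k, |Kt K t y0 y - Kt K t y0' y| ^ q) ^ (2 / q)
          / t) ^ (1 / 2 : ℝ) ≤
      C * Ck k * dist y0 y0' ^ (-(m * n / q')) *
        (1 + 2 ^ k * dist y0 y0') ^ (-N) * (2 : ℝ) ^ (-((k : ℝ) * m * n / q'))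

/-- Definition 1.1: a new multilinear square operator with generalized kernel. -/
structure IsGenSquareOp (n m : ℕ) (q q' : ℝ) (Ck : ℕ → ℝ)
    (K : En n → (Fin m → En n) → ℝ) : Prop where
  ck_pos : ∀ k, 0 < Ck k
  size : SizeCond n m K
  smooth : GenSmoothCond n m q q' Ck K
  weak_bound : ∃ s : Fin m → ℝ, (∀ j, 1 ≤ s j ∧ s j ≤ q') ∧ ∃ C > 0,
    ∀ f : Fin m → En n → ℝ, (∀ j, Measurable (f j)) →
      wLpWeak (∑ j, (s j)⁻¹)⁻¹ (fun _ => 1) (sqOp K f) ≤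
        ENNReal.ofReal C * ∏ j, wLp (s j) (fun _ => 1) (f j)

/-- The multiple weight `ν_{ω⃗} = ∏ ω_j^{p/p_j}`. -/
def nuW {n m : ℕ} (p : Fin m → ℝ) (w : Fin m → En n → ℝ) (x : En n) : ℝ :=
  ∏ j, w j x ^ ((∑ i, (p i)⁻¹)⁻¹ / p j)

/-- The multiple weight class `A_{p⃗}^θ(φ)`. -/
def MultiApTheta (n m : ℕ) (p : Fin m → ℝ) (θ : ℝ) (w : Fin m → En n → ℝ) : Prop :=
  (∀ j x, 0 ≤ w j x) ∧ (∀ j, LocallyIntegrable (w j) volume) ∧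
  ∃ C > 0, ∀ (x : En n) (r : ℝ), 0 < r →
    ((ENNReal.ofReal ((1 + r) ^ θ) * volume (cube x r))⁻¹ *
        ∫⁻ y in cube x r, ENNReal.ofReal (nuW p w y)) ^ (∑ i, (p i)⁻¹) *
      ∏ j,
        (if p j = 1 then
          (essInf (fun y => ENNReal.ofReal (w j y)) (volume.restrict (cube x r)))⁻¹
        else
          ((ENNReal.ofReal ((1 + r) ^ θ) * volume (cube x r))⁻¹ *
            ∫⁻ y in cube x r,
              ENNReal.ofReal (w j y) ^ (1 - p j / (p j - 1))) ^ (1 - (p j)⁻¹))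
      ≤ ENNReal.ofReal C



/-- The scalar weight class `A_p^θ(φ)` (with the `ess inf` convention at `p = 1`). -/
def ApTheta (n : ℕ) (p θ : ℝ) (w : En n → ℝ) : Prop :=
  (∀ x, 0 ≤ w x) ∧ LocallyIntegrable w volume ∧
  ∃ C > 0, ∀ (x : En n) (r : ℝ), 0 < r →
    if p = 1 then
      (ENNReal.ofReal ((1 + r) ^ θ) * volume (cube x r))⁻¹ *
          (∫⁻ y in cube x r, ENNReal.ofReal (w y)) ≤
        ENNReal.ofReal C *
          essInf (fun y => ENNReal.ofReal (w y)) (volume.restrict (cube x r))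
    else
      ((ENNReal.ofReal ((1 + r) ^ θ) * volume (cube x r))⁻¹ *
          ∫⁻ y in cube x r, ENNReal.ofReal (w y)) ^ (1 / p) *
        ((ENNReal.ofReal ((1 + r) ^ θ) * volume (cube x r))⁻¹ *
          ∫⁻ y in cube x r, ENNReal.ofReal (w y) ^ (-1 / (p - 1))) ^ (1 - 1 / p) ≤
        ENNReal.ofReal C

/-- Dyadic cube of generation `k` indexed by `v ∈ ℤⁿ`; its sidelength is `2^{-k}`. -/
def dyadicCube (n : ℕ) (k : ℤ) (v : Fin n → ℤ) : Set (En n) :=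
  {y | ∀ i, (v i : ℝ) * 2 ^ (-k) ≤ y i ∧ y i < ((v i : ℝ) + 1) * 2 ^ (-k)}

/-- Average of `f` on `Q`. -/
def cubeAvg {n : ℕ} (Q : Set (En n)) (f : En n → ℝ) : ℝ :=
  (volume Q).toReal⁻¹ * ∫ y in Q, f y

/-- The dyadic maximal function `M^△_{φ,η}`. -/
def dyadicMax (n : ℕ) (η : ℝ) (f : En n → ℝ) (x : En n) : ℝ≥0∞ :=
  ⨆ (k : ℤ) (v : Fin n → ℤ) (_ : x ∈ dyadicCube n k v),
    (ENNReal.ofReal ((1 + (2 : ℝ) ^ (-k)) ^ η) * volume (dyadicCube n k v))⁻¹ *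
      ∫⁻ y in dyadicCube n k v, ENNReal.ofReal |f y|

/-- The dyadic sharp maximal function `M^{♯,△}_{φ,η}`. -/
def sharpMax (n : ℕ) (η : ℝ) (f : En n → ℝ) (x : En n) : ℝ≥0∞ :=
  (⨆ (k : ℤ) (v : Fin n → ℤ) (_ : x ∈ dyadicCube n k v) (_ : (2 : ℝ) ^ (-k) < 1),
      (volume (dyadicCube n k v))⁻¹ *
        ∫⁻ y in dyadicCube n k v,
          ENNReal.ofReal |f y - cubeAvg (dyadicCube n k v) f|) +
  ⨆ (k : ℤ) (v : Fin n → ℤ) (_ : x ∈ dyadicCube n k v) (_ : 1 ≤ (2 : ℝ) ^ (-k)),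
    (ENNReal.ofReal ((1 + (2 : ℝ) ^ (-k)) ^ η) * volume (dyadicCube n k v))⁻¹ *
      ∫⁻ y in dyadicCube n k v, ENNReal.ofReal |f y|

def dyadicMaxDelta (n : ℕ) (δ η : ℝ) (f : En n → ℝ) (x : En n) : ℝ≥0∞ :=
  (dyadicMax n η (fun y => |f y| ^ δ) x) ^ (1 / δ)

def sharpMaxDelta (n : ℕ) (δ η : ℝ) (f : En n → ℝ) (x : En n) : ℝ≥0∞ :=
  (sharpMax n η (fun y => |f y| ^ δ) x) ^ (1 / δ)

/-- The multilinear maximal operator `𝓜_{φ,η}`. -/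
def multiMax (n m : ℕ) (η : ℝ) (f : Fin m → En n → ℝ) (x : En n) : ℝ≥0∞ :=
  ⨆ (c : En n) (r : ℝ) (_ : 0 < r) (_ : x ∈ cube c r),
    ∏ j, (ENNReal.ofReal ((1 + r) ^ η) * volume (cube c r))⁻¹ *
      ∫⁻ y in cube c r, ENNReal.ofReal |f j y|

def multiMaxDelta (n m : ℕ) (δ η : ℝ) (f : Fin m → En n → ℝ) (x : En n) : ℝ≥0∞ :=
  (multiMax n m η (fun j y => |f j y| ^ δ) x) ^ (1 / δ)

/-- `L^l` "norm" (in `z`) of an `ℝ≥0∞`-valued function, allowing `l = ∞`. -/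
def lpFull (n : ℕ) (l : ℝ≥0∞) (g : En n → ℝ≥0∞) : ℝ≥0∞ :=
  if l = ∞ then essSup g volume
  else (∫⁻ z, g z ^ l.toReal) ^ (1 / l.toReal)

/-- Weighted `L^p` norm of `f` restricted to `Q`, i.e. `‖f χ_Q‖_{L^p(w)}`. -/
def wLpOn {n : ℕ} (Q : Set (En n)) (p : ℝ) (w f : En n → ℝ) : ℝ≥0∞ :=
  (∫⁻ x in Q, ENNReal.ofReal (|f x| ^ p * w x)) ^ (1 / p)

/-- Weighted weak `L^p` norm of `f χ_Q`. -/
def wLpWeakOn {n : ℕ} (Q : Set (En n)) (p : ℝ) (w f : En n → ℝ) : ℝ≥0∞ :=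
  ⨆ (t : ℝ) (_ : 0 < t), ENNReal.ofReal t *
    (∫⁻ x in Q ∩ {x | t < |f x|}, ENNReal.ofReal (w x)) ^ (1 / p)

/-- `u(Q) = ∫_Q u`. -/
def wInt {n : ℕ} (Q : Set (En n)) (u : En n → ℝ) : ℝ≥0∞ :=
  ∫⁻ x in Q, ENNReal.ofReal (u x)

/-- The strong Morrey norm `‖f‖_{M^{p,l}_{α,λ}(u,w)}`. -/
def morreyNorm (n : ℕ) (α lam p : ℝ) (l : ℝ≥0∞) (u w f : En n → ℝ) : ℝ≥0∞ :=
  ⨆ (r : ℝ) (_ : 0 < r), lpFull n l fun z =>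
    ENNReal.ofReal ((1 + r) ^ α) * (wInt (cube z r) u) ^ (-lam) *
      wLpOn (cube z r) p w f

/-- The weak Morrey norm `‖f‖_{WM^{p,l}_{α,λ}(u,w)}`. -/
def weakMorreyNorm (n : ℕ) (α lam p : ℝ) (l : ℝ≥0∞) (u w f : En n → ℝ) : ℝ≥0∞ :=
  ⨆ (r : ℝ) (_ : 0 < r), lpFull n l fun z =>
    ENNReal.ofReal ((1 + r) ^ α) * (wInt (cube z r) u) ^ (-lam) *
      wLpWeakOn (cube z r) p w f

/-- The vector-valued Morrey norm `‖f⃗‖_{M^{p⃗,l}_{α,λ}(u,w⃗)}`. -/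
def vecMorreyNorm (n m : ℕ) (α lam : ℝ) (p : Fin m → ℝ) (l : ℝ≥0∞)
    (u : En n → ℝ) (w : Fin m → En n → ℝ) (f : Fin m → En n → ℝ) : ℝ≥0∞ :=
  ⨆ (r : ℝ) (_ : 0 < r), lpFull n l fun z =>
    ENNReal.ofReal ((1 + r) ^ α) * (wInt (cube z r) u) ^ (-lam) *
      ∏ j, wLpOn (cube z r) (p j) (w j) (f j)

/-- Weighted `L^p` norm of an `ℝ≥0∞`-valued function. -/
def wLpE (n : ℕ) (p : ℝ) (w : En n → ℝ) (g : En n → ℝ≥0∞) : ℝ≥0∞ :=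
  (∫⁻ x, g x ^ p * ENNReal.ofReal (w x)) ^ (1 / p)

/-- Weighted weak `L^p` norm of an `ℝ≥0∞`-valued function. -/
def wLpWeakE (n : ℕ) (p : ℝ) (w : En n → ℝ) (g : En n → ℝ≥0∞) : ℝ≥0∞ :=
  ⨆ (t : ℝ) (_ : 0 < t), ENNReal.ofReal t *
    (∫⁻ x in {x | ENNReal.ofReal t < g x}, ENNReal.ofReal (w x)) ^ (1 / p)



namespace RH

variable {n : ℕ}

/-- Half-open box with lower corner `a` and side `r`. -/
def Hb (a : Fin n → ℝ) (r : ℝ) : Set (Fin n → ℝ) := Set.univ.pi fun i => Ico (a i) (a i + r)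

/-- Lower corner of the child box with index `t`. -/
def ch (a : Fin n → ℝ) (r : ℝ) (t : Fin n → Bool) : Fin n → ℝ :=
  fun i => if t i then a i + r / 2 else a i

/-- Index of the child containing `x`. -/
def cc (a : Fin n → ℝ) (r : ℝ) (x : Fin n → ℝ) : Fin n → Bool :=
  fun i => decide (a i + r / 2 ≤ x i)

lemma measurableSet_Hb (a : Fin n → ℝ) (r : ℝ) : MeasurableSet (Hb a r) :=
  MeasurableSet.univ_pi fun _ => measurableSet_Ico

lemma volume_Hb (a : Fin n → ℝ) (r : ℝ) : volume (Hb a r) = ENNReal.ofReal r ^ n := by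
  simp [Hb, Real.volume_pi_Ico]

lemma mem_ch_iff (a : Fin n → ℝ) {r : ℝ} (hr : 0 < r) (t : Fin n → Bool) (x : Fin n → ℝ) :
    x ∈ Hb (ch a r t) (r / 2) ↔ x ∈ Hb a r ∧ cc a r x = t := by
  simp only [Hb, Set.mem_univ_pi, mem_Ico, ch, cc, funext_iff, ← forall_and]
  refine forall_congr' fun i => ?_
  cases t i <;> simp only [Bool.false_eq_true, if_false, if_true, decide_eq_false_iff_not, not_le,
    decide_eq_true_eq] <;> constructor <;> intro h
  · exact ⟨⟨h.1, by linarith⟩, by linarith⟩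
  · exact ⟨h.1.1, h.2⟩
  · exact ⟨⟨by linarith, by linarith⟩, h.1⟩
  · exact ⟨h.2, by linarith⟩

lemma split (a : Fin n → ℝ) {r : ℝ} (hr : 0 < r) (g : (Fin n → ℝ) → ℝ≥0∞) :
    ∫⁻ x in Hb a r, g x = ∑ t, ∫⁻ x in Hb (ch a r t) (r / 2), g x := by
  rw [← lintegral_biUnion_finset]
  · congr 2
    ext x
    simp only [mem_iUnion, mem_ch_iff a hr]
    simp
  · intro t _ t' _ htt
    refine Set.disjoint_left.2 fun x hx hx' => htt ?_
    rw [mem_ch_iff a hr] at hx hx'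
    exact hx.2.symm.trans hx'.2
  · exact fun t _ => measurableSet_Hb _ _

lemma measurable_cc (a : Fin n → ℝ) (r : ℝ) : Measurable (cc a r) := by
  refine measurable_pi_lambda _ fun i => ?_
  refine measurable_to_bool ?_
  have : (fun x : Fin n → ℝ => decide (a i + r / 2 ≤ x i)) ⁻¹' {true}
      = {x | a i + r / 2 ≤ x i} := by ext x; simp
  unfold cc
  rw [this]
  exact measurableSet_le measurable_const (measurable_pi_apply i)

/-- Average of `s`. -/
def av (s : (Fin n → ℝ) → ℝ≥0∞) (a : Fin n → ℝ) (r : ℝ) : ℝ≥0∞ :=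
  (∫⁻ x in Hb a r, s x) / volume (Hb a r)

/-- Conditional expectation on descendants of generation `m`. -/
def ce (s : (Fin n → ℝ) → ℝ≥0∞) : ℕ → (Fin n → ℝ) → ℝ → (Fin n → ℝ) → ℝ≥0∞
  | 0, a, r, _ => av s a r
  | m + 1, a, r, x => ce s m (ch a r (cc a r x)) (r / 2) x

/-- Stopping set. -/
def St (s : (Fin n → ℝ) → ℝ≥0∞) (l : ℝ≥0∞) : ℕ → (Fin n → ℝ) → ℝ → Set (Fin n → ℝ)
  | 0, a, r => {_x | l < av s a r}
  | m + 1, a, r => {x | l < av s a r ∨ x ∈ St s l m (ch a r (cc a r x)) (r / 2)}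

lemma measurable_ce (s : (Fin n → ℝ) → ℝ≥0∞) (m : ℕ) :
    ∀ (a : Fin n → ℝ) (r : ℝ), Measurable (ce s m a r) := by
  induction m with
  | zero => exact fun a r => measurable_const
  | succ m ih =>
    intro a r
    have h : Measurable (fun q : (Fin n → ℝ) × (Fin n → Bool) =>
        ce s m (ch a r q.2) (r / 2) q.1) :=
      measurable_from_prod_countable_left fun t => ih (ch a r t) (r / 2)
    exact h.comp (measurable_id.prodMk (measurable_cc a r))

lemma measurableSet_St (s : (Fin n → ℝ) → ℝ≥0∞) (l : ℝ≥0∞) (m : ℕ) :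
    ∀ (a : Fin n → ℝ) (r : ℝ), MeasurableSet (St s l m a r) := by
  induction m with
  | zero => exact fun a r => MeasurableSet.const _
  | succ m ih =>
    intro a r
    have h : Measurable (fun q : (Fin n → ℝ) × (Fin n → Bool) =>
        q.1 ∈ St s l m (ch a r q.2) (r / 2)) :=
      measurable_from_prod_countable_left fun t => measurable_mem.2 (ih (ch a r t) (r / 2))
    have h2 := h.comp (measurable_id.prodMk (measurable_cc a r))
    exact (MeasurableSet.const _).union (measurableSet_setOfPred.2 h2)

lemma ce_exists (s : (Fin n → ℝ) → ℝ≥0∞) (m : ℕ) :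
    ∀ (a : Fin n → ℝ) (r : ℝ), 0 < r → ∀ x ∈ Hb a r,
      ∃ b, x ∈ Hb b (r / 2 ^ m) ∧ ce s m a r x = av s b (r / 2 ^ m) ∧
        Hb b (r / 2 ^ m) ⊆ Hb a r := by
  induction m with
  | zero => intro a r hr x hx; exact ⟨a, by simpa using hx, by simp [ce], by simp⟩
  | succ m ih =>
    intro a r hr x hx
    obtain ⟨b, h1, h2, h3⟩ := ih (ch a r (cc a r x)) (r / 2) (by positivity) x
      ((mem_ch_iff a hr _ x).2 ⟨hx, rfl⟩)
    have e : r / 2 / 2 ^ m = r / 2 ^ (m + 1) := by rw [pow_succ]; field_simp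
    rw [e] at h1 h2 h3
    exact ⟨b, h1, h2, h3.trans fun y hy => ((mem_ch_iff a hr _ y).1 hy).1⟩

lemma vol_ne_zero (a : Fin n → ℝ) {r : ℝ} (hr : 0 < r) : volume (Hb a r) ≠ 0 := by
  rw [volume_Hb]; simp [hr]

lemma vol_ne_top (a : Fin n → ℝ) (r : ℝ) : volume (Hb a r) ≠ ∞ := by
  rw [volume_Hb]; simp

lemma av_mul_vol (s : (Fin n → ℝ) → ℝ≥0∞) (a : Fin n → ℝ) {r : ℝ} (hr : 0 < r) :
    av s a r * volume (Hb a r) = ∫⁻ x in Hb a r, s x :=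
  ENNReal.div_mul_cancel (vol_ne_zero a hr) (vol_ne_top a r)

lemma vol_child (a b : Fin n → ℝ) (r : ℝ) :
    volume (Hb a r) = 2 ^ n * volume (Hb b (r / 2)) := by
  rw [volume_Hb, volume_Hb, ← mul_pow]
  congr 1
  rw [show (2 : ℝ≥0∞) = ENNReal.ofReal 2 by simp, ← ENNReal.ofReal_mul (by norm_num)]
  congr 1; ring

lemma av_child (s : (Fin n → ℝ) → ℝ≥0∞) (a : Fin n → ℝ) {r : ℝ} (hr : 0 < r)
    (t : Fin n → Bool) : av s (ch a r t) (r / 2) ≤ 2 ^ n * av s a r := by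
  have h : ∫⁻ x in Hb (ch a r t) (r / 2), s x ≤ ∫⁻ x in Hb a r, s x :=
    lintegral_mono_set fun y hy => ((mem_ch_iff a hr _ y).1 hy).1
  unfold av
  rw [vol_child a (ch a r t) r]
  refine (ENNReal.div_le_div_right h _).trans (le_of_eq ?_)
  rw [ENNReal.div_eq_inv_mul, ENNReal.div_eq_inv_mul, ENNReal.mul_inv (by simp) (by simp), ← mul_assoc,
    ← mul_assoc, ENNReal.mul_inv_cancel (by simp) (by simp), one_mul]

/-- splitting for functions that depend on the child. -/
lemma split' (a : Fin n → ℝ) {r : ℝ} (hr : 0 < r) (g : (Fin n → Bool) → (Fin n → ℝ) → ℝ≥0∞) :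
    ∫⁻ x in Hb a r, g (cc a r x) x = ∑ t, ∫⁻ x in Hb (ch a r t) (r / 2), g t x := by
  rw [split a hr]
  refine Finset.sum_congr rfl fun t _ => ?_
  refine setLIntegral_congr_fun (measurableSet_Hb _ _) fun x hx => ?_
  simp only [((mem_ch_iff a hr t x).1 hx).2]

lemma split_St (s : (Fin n → ℝ) → ℝ≥0∞) (l : ℝ≥0∞) (m : ℕ) (a : Fin n → ℝ) {r : ℝ}
    (hr : 0 < r) (hl : ¬ l < av s a r) (g : (Fin n → ℝ) → ℝ≥0∞) :
    ∫⁻ x in Hb a r, (St s l (m + 1) a r).indicator g x =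
      ∑ t, ∫⁻ x in Hb (ch a r t) (r / 2), (St s l m (ch a r t) (r / 2)).indicator g x := by
  rw [← split' a hr (fun t x => (St s l m (ch a r t) (r / 2)).indicator g x)]
  congr 1
  ext x
  have : x ∈ St s l (m + 1) a r ↔ x ∈ St s l m (ch a r (cc a r x)) (r / 2) := by
    simp [St, hl]
  by_cases hx : x ∈ St s l (m + 1) a r
  · rw [indicator_of_mem hx, indicator_of_mem (this.1 hx)]
  · rw [indicator_of_notMem hx, indicator_of_notMem fun h => hx (this.2 h)]

lemma St_univ (s : (Fin n → ℝ) → ℝ≥0∞) (l : ℝ≥0∞) (m : ℕ) (a : Fin n → ℝ) (r : ℝ)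
    (hl : l < av s a r) : St s l m a r = Set.univ := by
  cases m <;> simp [St, hl]

lemma weak_type (s : (Fin n → ℝ) → ℝ≥0∞) (l : ℝ≥0∞) (m : ℕ) :
    ∀ (a : Fin n → ℝ) (r : ℝ), 0 < r →
      l * ∫⁻ x in Hb a r, (St s l m a r).indicator 1 x ≤
        ∫⁻ x in Hb a r, (St s l m a r).indicator s x := by
  have key : ∀ m (a : Fin n → ℝ) (r : ℝ), 0 < r → l < av s a r →
      l * ∫⁻ x in Hb a r, (St s l m a r).indicator 1 x ≤
        ∫⁻ x in Hb a r, (St s l m a r).indicator s x := by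
    intro m a r hr hl
    rw [St_univ s l m a r hl]
    simp only [indicator_univ, Pi.one_apply, lintegral_const, one_mul, Measure.restrict_apply_univ]
    rw [← av_mul_vol s a hr]
    gcongr
  induction m with
  | zero =>
    intro a r hr
    by_cases hl : l < av s a r
    · exact key 0 a r hr hl
    · simp [St, hl]
  | succ m ih =>
    intro a r hr
    by_cases hl : l < av s a r
    · exact key _ a r hr hl
    · rw [split_St s l m a hr hl, split_St s l m a hr hl, Finset.mul_sum]
      exact Finset.sum_le_sum fun t _ => ih _ _ (by positivity)

/-- The claim of reverse Hölder at level `m`. -/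
def PP (s : (Fin n → ℝ) → ℝ≥0∞) (δ : ℝ) (K : ℝ≥0∞) (m : ℕ) : Prop :=
  ∀ (a : Fin n → ℝ) (r : ℝ), 0 < r → r ≤ 1 →
    ∫⁻ x in Hb a r, ce s m a r x ^ (1 + δ) ≤ K * av s a r ^ δ * ∫⁻ x in Hb a r, s x

lemma PP_zero (s : (Fin n → ℝ) → ℝ≥0∞) {δ : ℝ} (hδ : 0 ≤ δ) {K : ℝ≥0∞} (hK : 1 ≤ K) :
    PP s δ K 0 := by
  intro a r hr _
  simp only [ce, lintegral_const, Measure.restrict_apply_univ]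
  rw [ENNReal.rpow_add_of_nonneg _ _ zero_le_one hδ, ENNReal.rpow_one, mul_comm (av s a r), mul_assoc,
    av_mul_vol s a hr, mul_assoc]
  exact le_mul_of_one_le_left (zero_le) hK

lemma step (s : (Fin n → ℝ) → ℝ≥0∞) (l : ℝ≥0∞) {δ : ℝ} (hδ : 0 ≤ δ) {K : ℝ≥0∞} (m : ℕ) :
    (∀ j ≤ m, PP s δ K j) → ∀ (a : Fin n → ℝ) (r : ℝ), 0 < r → r ≤ 1 → av s a r ≤ 2 ^ n * l →
      ∫⁻ x in Hb a r, ce s m a r x ^ (1 + δ) ≤ l ^ δ * (∫⁻ x in Hb a r, s x) +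
        K * (2 ^ n * l) ^ δ * ∫⁻ x in Hb a r, (St s l m a r).indicator s x := by
  have key : ∀ m, PP s δ K m → ∀ (a : Fin n → ℝ) (r : ℝ), 0 < r → r ≤ 1 →
      av s a r ≤ 2 ^ n * l → l < av s a r →
      ∫⁻ x in Hb a r, ce s m a r x ^ (1 + δ) ≤ l ^ δ * (∫⁻ x in Hb a r, s x) +
        K * (2 ^ n * l) ^ δ * ∫⁻ x in Hb a r, (St s l m a r).indicator s x := by
    intro m hm a r hr hr1 h1 h2
    refine (hm a r hr hr1).trans (le_add_left ?_)
    rw [St_univ s l m a r h2, indicator_univ]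
    gcongr
  induction m with
  | zero =>
    intro hP a r hr hr1 h1
    by_cases hl : l < av s a r
    · exact key 0 (hP 0 le_rfl) a r hr hr1 h1 hl
    · refine (PP_zero s hδ le_rfl a r hr hr1).trans (le_add_right ?_)
      rw [one_mul]
      gcongr
      exact not_lt.1 hl
  | succ m ih =>
    intro hP a r hr hr1 h1
    by_cases hl : l < av s a r
    · exact key _ (hP _ le_rfl) a r hr hr1 h1 hl
    · rw [split_St s l m a hr hl, split a hr s, Finset.mul_sum, Finset.mul_sum,
        ← Finset.sum_add_distrib]
      simp only [ce]
      rw [split' a hr (fun t x => ce s m (ch a r t) (r / 2) x ^ (1 + δ))]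
      refine Finset.sum_le_sum fun t _ => ih (fun j hj => hP j (by omega)) _ _ (by positivity)
        (by linarith) ((av_child s a hr t).trans ?_)
      gcongr
      exact not_lt.1 hl

lemma main_step (s : (Fin n → ℝ) → ℝ≥0∞) {δ : ℝ} (hδ : 0 ≤ δ) {K β : ℝ≥0∞}
    (hfin : ∀ (a : Fin n → ℝ) (r : ℝ), 0 < r → ∫⁻ x in Hb a r, s x ≠ ∞)
    (hpos : ∀ (a : Fin n → ℝ) (r : ℝ), 0 < r → ∫⁻ x in Hb a r, s x ≠ 0)
    (hA : ∀ (a : Fin n → ℝ) (r : ℝ), 0 < r → r ≤ 1 → ∀ E, MeasurableSet E →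
      2 * volume (Hb a r ∩ E) ≤ volume (Hb a r) →
      ∫⁻ x in Hb a r ∩ E, s x ≤ β * ∫⁻ x in Hb a r, s x)
    (hK1 : 1 ≤ K) (hK : 2 ^ δ + K * (2 ^ n * 2) ^ δ * β ≤ K) (m : ℕ) : PP s δ K m := by
  induction m using Nat.strong_induction_on with
  | _ m ih =>
    cases m with
    | zero => exact PP_zero s hδ hK1
    | succ m =>
      intro a r hr hr1
      set A := av s a r with hAdef
      set l := 2 * A with hl
      have hA0 : A ≠ 0 := by
        rw [hAdef, av]
        exact ENNReal.div_ne_zero.2 ⟨hpos a r hr, vol_ne_top a r⟩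
      have hAt : A ≠ ∞ := ENNReal.div_ne_top (hfin a r hr) (vol_ne_zero a hr)
      have hAl : A ≤ l := by rw [hl, two_mul]; exact le_self_add
      have h1 : ∫⁻ x in Hb a r, ce s (m + 1) a r x ^ (1 + δ) ≤ l ^ δ * (∫⁻ x in Hb a r, s x) +
          K * (2 ^ n * l) ^ δ * ∫⁻ x in Hb a r, (St s l (m + 1) a r).indicator s x := by
        rw [split_St s l m a hr (not_lt.2 hAl), split a hr s, Finset.mul_sum, Finset.mul_sum,
          ← Finset.sum_add_distrib]
        simp only [ce]
        rw [split' a hr (fun t x => ce s m (ch a r t) (r / 2) x ^ (1 + δ))]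
        refine Finset.sum_le_sum fun t _ => step s l hδ m (fun j hj => ih j (by omega)) _ _
          (by positivity) (by linarith) ((av_child s a hr t).trans ?_)
        gcongr
      have hE := measurableSet_St s l (m + 1) a r
      have h2 := weak_type s l (m + 1) a r hr
      have h3 : ∫⁻ x in Hb a r, (St s l (m + 1) a r).indicator s x ≤ β * ∫⁻ x in Hb a r, s x := by
        rw [setLIntegral_indicator hE, inter_comm]
        refine hA a r hr hr1 _ hE ?_
        have h4 : ∫⁻ x in Hb a r, (St s l (m + 1) a r).indicator s x ≤ A * volume (Hb a r) := by
          rw [hAdef, av_mul_vol s a hr]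
          exact lintegral_mono fun x => indicator_le_self _ _ _
        have h5 := h2.trans h4
        rw [setLIntegral_indicator hE, inter_comm] at h5
        simp only [Pi.one_apply, lintegral_const, one_mul, Measure.restrict_apply_univ] at h5
        have h6 : l * volume (Hb a r ∩ St s l (m + 1) a r)
            = A * (2 * volume (Hb a r ∩ St s l (m + 1) a r)) := by
          rw [← mul_assoc, mul_comm A 2]
        rw [h6] at h5
        exact (ENNReal.mul_le_mul_iff_right hA0 hAt).1 h5
      refine h1.trans ?_
      calc l ^ δ * (∫⁻ x in Hb a r, s x) +
          K * (2 ^ n * l) ^ δ * ∫⁻ x in Hb a r, (St s l (m + 1) a r).indicator s x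
          ≤ l ^ δ * (∫⁻ x in Hb a r, s x) +
          K * (2 ^ n * l) ^ δ * (β * ∫⁻ x in Hb a r, s x) := by gcongr
        _ = (2 ^ δ + K * (2 ^ n * 2) ^ δ * β) * A ^ δ * ∫⁻ x in Hb a r, s x := by
          rw [hl, ← mul_assoc (2 ^ n) 2 A, ENNReal.mul_rpow_of_nonneg _ A hδ, ENNReal.mul_rpow_of_nonneg _ A hδ]
          ring
        _ ≤ _ := by gcongr

lemma Hb_ae_eq (b : Fin n → ℝ) {r : ℝ} (hr : 0 < r) :
    (Hb b r : Set (Fin n → ℝ)) =ᵐ[volume] Metric.closedBall (fun i => b i + r / 2) (r / 2) := by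
  have h : Metric.closedBall (fun i => b i + r / 2) (r / 2) = Icc b (fun i => b i + r) := by
    rw [closedBall_pi _ (by positivity)]
    ext x
    simp only [Real.closedBall_eq_Icc, Set.mem_univ_pi, mem_Icc, Pi.le_def, ← forall_and]
    refine forall_congr' fun i => ?_
    constructor <;> rintro ⟨h1, h2⟩ <;> constructor <;> linarith
  rw [h]
  exact Measure.univ_pi_Ico_ae_eq_Icc

lemma ce_tendsto (s : (Fin n → ℝ) → ℝ≥0∞) (hs : AEMeasurable s volume) (a : Fin n → ℝ) {r : ℝ}
    (hr : 0 < r) (hfin : ∫⁻ x in Hb a r, s x ≠ ∞) :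
    ∀ᵐ x ∂(volume : Measure (Fin n → ℝ)), x ∈ Hb a r →
      Tendsto (fun m => ce s m a r x) atTop (nhds (s x)) := by
  have hg : AEMeasurable ((Hb a r).indicator s) volume := hs.indicator (measurableSet_Hb a r)
  have hgi : ∫⁻ y, (Hb a r).indicator s y ≠ ∞ := by
    rwa [lintegral_indicator (measurableSet_Hb a r)]
  have := VitaliFamily.ae_tendsto_lintegral_div
    (IsUnifLocDoublingMeasure.vitaliFamily (volume : Measure (Fin n → ℝ)) 1) hg hgi
  filter_upwards [this] with x hx hxH
  choose b hb1 hb2 hb3 using fun m => ce_exists s m a r hr x hxH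
  have hrm : ∀ m : ℕ, 0 < r / 2 ^ m := fun m => by positivity
  have hT : Tendsto (fun m : ℕ => r / 2 ^ m / 2) atTop (nhdsWithin 0 (Ioi 0)) := by
    refine tendsto_nhdsWithin_iff.2 ⟨?_, Eventually.of_forall fun m => ?_⟩
    · have h := (tendsto_pow_atTop_nhds_zero_of_lt_one (r := (1 / 2 : ℝ)) (by norm_num)
        (by norm_num)).const_mul (r / 2)
      rw [mul_zero] at h
      refine h.congr fun m => ?_
      rw [one_div, inv_pow]; field_simp
    · have := hrm m
      exact mem_Ioi.2 (by positivity)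
  have h1 := IsUnifLocDoublingMeasure.tendsto_closedBall_filterAt (volume : Measure (Fin n → ℝ))
    (K := 1) (x := x) (fun m i => b m i + r / 2 ^ m / 2) (fun m => r / 2 ^ m / 2) hT
    (Eventually.of_forall fun m => by
      rw [one_mul, closedBall_pi _ (by have := hrm m; positivity)]
      have h := hb1 m
      simp only [Hb, Set.mem_univ_pi, mem_Ico, Real.closedBall_eq_Icc, mem_Icc] at h ⊢
      intro i
      constructor <;> linarith [(h i).1, (h i).2])
  have h2 := hx.comp h1
  rw [indicator_of_mem hxH] at h2
  refine h2.congr fun m => ?_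
  simp only [Function.comp]
  rw [hb2 m, av, ← measure_congr (Hb_ae_eq (b m) (hrm m)),
    ← setLIntegral_congr (Hb_ae_eq (b m) (hrm m)), setLIntegral_indicator (measurableSet_Hb a r),
    inter_eq_right.2 (hb3 m)]

lemma local_RH (s : (Fin n → ℝ) → ℝ≥0∞) (hs : AEMeasurable s volume) {δ : ℝ} {K : ℝ≥0∞}
    (hfin : ∀ (a : Fin n → ℝ) (r : ℝ), 0 < r → ∫⁻ x in Hb a r, s x ≠ ∞)
    (hP : ∀ m, PP s δ K m) (a : Fin n → ℝ) (r : ℝ) (hr : 0 < r) (hr1 : r ≤ 1) :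
    ∫⁻ x in Hb a r, s x ^ (1 + δ) ≤ K * av s a r ^ δ * ∫⁻ x in Hb a r, s x := by
  have h1 := ce_tendsto s hs a hr (hfin a r hr)
  have h2 : ∫⁻ x in Hb a r, s x ^ (1 + δ) =
      ∫⁻ x in Hb a r, liminf (fun m => ce s m a r x ^ (1 + δ)) atTop := by
    refine lintegral_congr_ae ?_
    refine (ae_restrict_iff' (measurableSet_Hb a r)).2 ?_
    filter_upwards [h1] with x hx hxH
    exact ((ENNReal.continuous_rpow_const.tendsto _).comp (hx hxH)).liminf_eq.symm
  rw [h2]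
  refine (lintegral_liminf_le fun m => (measurable_ce s m a r).pow_const _).trans ?_
  refine (liminf_le_liminf (Eventually.of_forall fun m => hP m a r hr hr1)).trans ?_
  simp

lemma local_RH' (s : (Fin n → ℝ) → ℝ≥0∞) {δ : ℝ} {K : ℝ≥0∞}
    (hδ : 0 ≤ δ)
    (h : ∀ (a : Fin n → ℝ) (r : ℝ), 0 < r → r ≤ 1 →
      ∫⁻ x in Hb a r, s x ^ (1 + δ) ≤ K * av s a r ^ δ * ∫⁻ x in Hb a r, s x)
    (a : Fin n → ℝ) (r : ℝ) (hr : 0 < r) (hr1 : r ≤ 1) :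
    ∫⁻ x in Hb a r, s x ^ (1 + δ) ≤
      K * ENNReal.ofReal (r⁻¹ ^ (n * δ)) * (∫⁻ x in Hb a r, s x) ^ (1 + δ) := by
  refine (h a r hr hr1).trans (le_of_eq ?_)
  have e : ENNReal.ofReal (r⁻¹ ^ (n * δ)) = ((ENNReal.ofReal r ^ n)⁻¹) ^ δ := by
    rw [Real.rpow_mul (by positivity), Real.rpow_natCast,
      ← ENNReal.ofReal_rpow_of_nonneg (by positivity) hδ, ENNReal.ofReal_pow (by positivity),
      ENNReal.ofReal_inv_of_pos hr, ENNReal.inv_pow]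
  rw [e, av, volume_Hb, ENNReal.div_eq_inv_mul, ENNReal.mul_rpow_of_nonneg _ _ hδ,
    ENNReal.rpow_add_of_nonneg _ _ zero_le_one hδ, ENNReal.rpow_one]
  ring

lemma large_RH (s : (Fin n → ℝ) → ℝ≥0∞) {δ : ℝ} {K : ℝ≥0∞}
    (hδ : 0 ≤ δ)
    (h : ∀ (a : Fin n → ℝ) (r : ℝ), 1 / 2 ≤ r → r ≤ 1 →
      ∫⁻ x in Hb a r, s x ^ (1 + δ) ≤ K * (∫⁻ x in Hb a r, s x) ^ (1 + δ)) (k : ℕ) :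
    ∀ (a : Fin n → ℝ) (r : ℝ), 1 / 2 ≤ r → r ≤ 2 ^ k →
    ∫⁻ x in Hb a r, s x ^ (1 + δ) ≤ K * (∫⁻ x in Hb a r, s x) ^ (1 + δ) := by
  induction k with
  | zero => simpa using h
  | succ k ih =>
    intro a r hr hrk
    by_cases hr1 : r ≤ 1
    · exact h a r hr hr1
    push Not at hr1
    have hr0 : 0 < r := by linarith
    rw [split a hr0]
    calc _ ≤ ∑ t, K * (∫⁻ x in Hb (ch a r t) (r / 2), s x) ^ (1 + δ) :=
          Finset.sum_le_sum fun t _ => ih _ _ (by linarith) (by rw [pow_succ] at hrk; linarith)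
      _ ≤ ∑ t, K * ((∫⁻ x in Hb a r, s x) ^ δ * (∫⁻ x in Hb (ch a r t) (r / 2), s x)) := by
          refine Finset.sum_le_sum fun t _ => ?_
          rw [ENNReal.rpow_add_of_nonneg _ _ zero_le_one hδ, ENNReal.rpow_one, mul_comm (lintegral _ _)]
          have : ∫⁻ x in Hb (ch a r t) (r / 2), s x ≤ ∫⁻ x in Hb a r, s x :=
            lintegral_mono_set fun y hy => ((mem_ch_iff a hr0 _ y).1 hy).1
          gcongr
      _ = _ := by
          rw [← Finset.mul_sum, ← Finset.mul_sum, ← split a hr0 s,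
            ENNReal.rpow_add_of_nonneg _ _ zero_le_one hδ, ENNReal.rpow_one,
            mul_comm (_ ^ δ)]

/-- Reverse Hölder with polynomial growth for all boxes. -/
lemma full_RH (s : (Fin n → ℝ) → ℝ≥0∞) (hs : AEMeasurable s volume) {δ : ℝ} {K : ℝ}
    (hδ : 0 ≤ δ) (hfin : ∀ (a : Fin n → ℝ) (r : ℝ), 0 < r → ∫⁻ x in Hb a r, s x ≠ ∞)
    (hP : ∀ m, PP s δ (ENNReal.ofReal K) m) (hK0 : 0 ≤ K) (a : Fin n → ℝ) (r : ℝ) (hr : 0 < r) :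
    ∫⁻ x in Hb a r, s x ^ (1 + δ) ≤
      ENNReal.ofReal (K * 2 ^ (n * δ) * ((1 + r) / r) ^ (n * δ)) *
        (∫⁻ x in Hb a r, s x) ^ (1 + δ) := by
  have hnd : 0 ≤ n * δ := by positivity
  have hl := local_RH' s hδ (local_RH s hs hfin hP)
  have h2 : (1 : ℝ) ≤ 2 ^ (n * δ) := Real.one_le_rpow (by norm_num) hnd
  by_cases hr1 : r ≤ 1
  · refine (hl a r hr hr1).trans ?_
    rw [← ENNReal.ofReal_mul hK0]
    gcongr
    · exact le_mul_of_one_le_right hK0 h2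
    · rw [inv_eq_one_div]; gcongr; linarith
  · push Not at hr1
    obtain ⟨k, hk⟩ := pow_unbounded_of_one_lt r (by norm_num : (1 : ℝ) < 2)
    refine (large_RH s (K := ENNReal.ofReal (K * 2 ^ (n * δ))) hδ ?_ k a r (by linarith)
      hk.le).trans ?_
    · intro a r hr hr1
      refine (hl a r (by linarith) hr1).trans ?_
      rw [← ENNReal.ofReal_mul hK0]
      gcongr
      rw [inv_le_comm₀ (by linarith) (by norm_num)]
      linarith
    · refine mul_le_mul' (ENNReal.ofReal_le_ofReal ?_) le_rfl
      refine le_mul_of_one_le_right (by positivity) (Real.one_le_rpow ?_ hnd)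
      rw [one_le_div hr]; linarith

lemma Ainf (w : (Fin n → ℝ) → ℝ≥0∞) (hw : AEMeasurable w volume) (hwt : ∀ x, w x ≠ ∞)
    {p : ℝ} (hp : 1 < p) {C : ℝ} (hC : 1 ≤ C) (a : Fin n → ℝ) (r : ℝ) (hr : 0 < r)
    (hfin : ∫⁻ x in Hb a r, w x ^ (-1 / (p - 1)) ≠ ∞)
    (hAp : (∫⁻ x in Hb a r, w x) * (∫⁻ x in Hb a r, w x ^ (-1 / (p - 1))) ^ (p - 1) ≤
      ENNReal.ofReal C * volume (Hb a r) ^ p)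
    (E : Set (Fin n → ℝ)) (hE : MeasurableSet E)
    (hvE : 2 * volume (Hb a r ∩ E) ≤ volume (Hb a r)) :
    ∫⁻ x in Hb a r ∩ E, w x ^ (-1 / (p - 1)) ≤
      ENNReal.ofReal (1 - 1 / (2 ^ p * C) ^ (1 / (p - 1))) *
        ∫⁻ x in Hb a r, w x ^ (-1 / (p - 1)) := by
  have hp0 : 0 < p := by linarith
  have hp1 : 0 < p - 1 := by linarith
  set s : (Fin n → ℝ) → ℝ≥0∞ := fun x => w x ^ (-1 / (p - 1)) with hs
  have hsm : AEMeasurable s volume := hw.pow_const _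
  set H := Hb a r with hH
  set F := H \ E with hF
  have hHm : MeasurableSet H := measurableSet_Hb a r
  have hFm : MeasurableSet F := hHm.diff hE
  have hFH : F ⊆ H := sdiff_subset
  have hvt : volume H ≠ ∞ := vol_ne_top a r
  have hv0 : volume H ≠ 0 := vol_ne_zero a hr
  have hvF : volume H ≤ 2 * volume F := by
    have h1 : volume (H ∩ E) + volume F = volume H := measure_inter_add_sdiff H hE
    have h2 : volume H + volume H ≤ volume H + 2 * volume F := by
      calc volume H + volume H = 2 * volume (H ∩ E) + 2 * volume F := by
            rw [← mul_add, h1, two_mul]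
        _ ≤ _ := by gcongr
    exact (ENNReal.add_le_add_iff_left hvt).1 h2
  -- Hölder on F
  have hconj : p.HolderConjugate (p / (p - 1)) := Real.HolderConjugate.conjExponent hp
  have hHo := ENNReal.lintegral_mul_le_Lp_mul_Lq (volume.restrict F) hconj
    (f := fun x => w x ^ (1 / p)) (g := fun x => s x ^ ((p - 1) / p))
    (hw.restrict.pow_const _) (hsm.restrict.pow_const _)
  have e1 : ∀ x, (w x ^ (1 / p)) ^ p = w x := fun x => by
    rw [← ENNReal.rpow_mul, one_div_mul_cancel hp0.ne', ENNReal.rpow_one]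
  have e2 : ∀ x, (s x ^ ((p - 1) / p)) ^ (p / (p - 1)) = s x := fun x => by
    rw [← ENNReal.rpow_mul, show (p - 1) / p * (p / (p - 1)) = 1 by field_simp, ENNReal.rpow_one]
  simp only [e1, e2, Pi.mul_apply] at hHo
  have hsfin : ∀ᵐ x ∂(volume.restrict F), s x < ∞ := by
    refine ae_lt_top' hsm.restrict ?_
    exact ne_top_of_le_ne_top hfin (lintegral_mono_set hFH)
  have hone : volume F ≤ ∫⁻ x in F, w x ^ (1 / p) * s x ^ ((p - 1) / p) := by
    rw [← setLIntegral_one]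
    refine lintegral_mono_ae ?_
    filter_upwards [hsfin] with x hx
    have hw0 : w x ≠ 0 := by
      intro h0
      rw [hs] at hx
      simp only [h0] at hx
      rw [ENNReal.zero_rpow_of_neg (by rw [neg_div]; simp [hp1])] at hx
      exact lt_irrefl _ hx
    rw [hs]
    simp only
    rw [← ENNReal.rpow_mul, ← ENNReal.rpow_add _ _ hw0 (hwt x),
      show 1 / p + -1 / (p - 1) * ((p - 1) / p) = 0 by field_simp; ring, ENNReal.rpow_zero]
  have hFp : volume F ^ p ≤ (∫⁻ x in H, w x) * (∫⁻ x in F, s x) ^ (p - 1) := by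
    calc volume F ^ p ≤ ((∫⁻ x in F, w x) ^ (1 / p) *
          (∫⁻ x in F, s x) ^ (1 / (p / (p - 1)))) ^ p := by
            gcongr
            exact hone.trans hHo
      _ = (∫⁻ x in F, w x) * (∫⁻ x in F, s x) ^ (p - 1) := by
          rw [ENNReal.mul_rpow_of_nonneg _ _ hp0.le, ← ENNReal.rpow_mul, ← ENNReal.rpow_mul,
            one_div_mul_cancel hp0.ne', ENNReal.rpow_one,
            show 1 / (p / (p - 1)) * p = p - 1 by field_simp]
      _ ≤ _ := by gcongr
  have hmain : (∫⁻ x in H, s x) ^ (p - 1) ≤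
      ENNReal.ofReal (2 ^ p * C) * (∫⁻ x in F, s x) ^ (p - 1) := by
    have hvp0 : volume H ^ p ≠ 0 := by simp [hv0, hp0.not_gt, ENNReal.rpow_eq_zero_iff]
    have hvpt : volume H ^ p ≠ ∞ := ENNReal.rpow_ne_top_of_nonneg hp0.le hvt
    refine (ENNReal.mul_le_mul_iff_right hvp0 hvpt).1 ?_
    calc volume H ^ p * (∫⁻ x in H, s x) ^ (p - 1)
        ≤ (2 * volume F) ^ p * (∫⁻ x in H, s x) ^ (p - 1) := by gcongr
      _ = 2 ^ p * volume F ^ p * (∫⁻ x in H, s x) ^ (p - 1) := by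
          rw [ENNReal.mul_rpow_of_nonneg _ _ hp0.le]
      _ ≤ 2 ^ p * ((∫⁻ x in H, w x) * (∫⁻ x in F, s x) ^ (p - 1)) *
            (∫⁻ x in H, s x) ^ (p - 1) := by gcongr
      _ = 2 ^ p * ((∫⁻ x in H, w x) * (∫⁻ x in H, s x) ^ (p - 1)) *
            (∫⁻ x in F, s x) ^ (p - 1) := by ring
      _ ≤ 2 ^ p * (ENNReal.ofReal C * volume H ^ p) * (∫⁻ x in F, s x) ^ (p - 1) := by gcongr
      _ = _ := by
          rw [ENNReal.ofReal_mul (by positivity), ← ENNReal.ofReal_rpow_of_pos (by norm_num)]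
          simp only [ENNReal.ofReal_ofNat]
          ring
  set M : ℝ := (2 ^ p * C) ^ (1 / (p - 1)) with hM
  have hMpos : 0 < M := by positivity
  have hM1 : 1 ≤ M := by
    refine Real.one_le_rpow ?_ (by positivity)
    have : (1 : ℝ) ≤ 2 ^ p := Real.one_le_rpow (by norm_num) hp0.le
    nlinarith
  have hSM : ∫⁻ x in H, s x ≤ ENNReal.ofReal M * ∫⁻ x in F, s x := by
    refine (ENNReal.rpow_le_rpow_iff hp1).1 (hmain.trans (le_of_eq ?_))
    rw [ENNReal.mul_rpow_of_nonneg _ _ hp1.le, ENNReal.ofReal_rpow_of_pos hMpos, hM,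
      ← Real.rpow_mul (by positivity), one_div_mul_cancel hp1.ne', Real.rpow_one]
  have hsum : (∫⁻ x in H ∩ E, s x) + (∫⁻ x in F, s x) = ∫⁻ x in H, s x :=
    lintegral_inter_add_sdiff s H hE
  have hEt : ∫⁻ x in H ∩ E, s x ≠ ∞ := ne_top_of_le_ne_top hfin (hsum ▸ le_self_add)
  have hFt : ∫⁻ x in F, s x ≠ ∞ := ne_top_of_le_ne_top hfin (hsum ▸ le_add_self)
  rw [← ENNReal.ofReal_toReal hEt, ← ENNReal.ofReal_toReal hFt, ← ENNReal.ofReal_toReal hfin,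
    ← ENNReal.ofReal_add toReal_nonneg toReal_nonneg,
    ENNReal.ofReal_eq_ofReal_iff (by positivity) toReal_nonneg] at hsum
  rw [← ENNReal.ofReal_toReal hFt, ← ENNReal.ofReal_toReal hfin, ← ENNReal.ofReal_mul hMpos.le,
    ENNReal.ofReal_le_ofReal_iff (by positivity)] at hSM
  rw [← ENNReal.ofReal_toReal hEt, ← ENNReal.ofReal_toReal hfin, ← ENNReal.ofReal_mul]
  swap
  · rw [sub_nonneg, div_le_one hMpos]; exact hM1
  refine ENNReal.ofReal_le_ofReal ?_
  have h3 : (∫⁻ x in H, s x).toReal / M ≤ (∫⁻ x in F, s x).toReal := by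
    rw [div_le_iff₀ hMpos]; linarith
  have h4 : (1 - 1 / M) * (∫⁻ x in H, s x).toReal =
    (∫⁻ x in H, s x).toReal - (∫⁻ x in H, s x).toReal / M := by ring
  rw [h4]
  linarith

lemma exists_delta (n : ℕ) {β : ℝ} (h1 : β < 1) :
    ∃ δ : ℝ, 0 < δ ∧ δ ≤ 1 ∧ ((2 : ℝ) ^ n * 2) ^ δ * β ≤ (1 + β) / 2 := by
  have hc : Tendsto (fun δ : ℝ => ((2 : ℝ) ^ n * 2) ^ δ * β) (nhdsWithin 0 (Ioi 0)) (nhds (1 * β)) := by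
    refine Tendsto.mul_const _ ?_
    have := (Real.continuous_const_rpow (a := (2 : ℝ) ^ n * 2) (by positivity)).tendsto 0
    rw [Real.rpow_zero] at this
    exact this.mono_left nhdsWithin_le_nhds
  have he := hc.eventually (eventually_lt_nhds (b := (1 + β) / 2) (by linarith))
  have h2 : ∀ᶠ δ : ℝ in nhdsWithin 0 (Ioi 0), δ < 1 :=
    nhdsWithin_le_nhds (eventually_lt_nhds (by norm_num))
  obtain ⟨δ, ha, hb, hd⟩ := (he.and (h2.and self_mem_nhdsWithin)).exists
  exact ⟨δ, hd, hb.le, ha.le⟩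

lemma box_RH (w : (Fin n → ℝ) → ℝ≥0∞) (hw : AEMeasurable w volume) (hwt : ∀ x, w x ≠ ∞)
    {p : ℝ} (hp : 1 < p) {C : ℝ} (hC : 1 ≤ C)
    (hfin : ∀ (a : Fin n → ℝ) (r : ℝ), 0 < r → ∫⁻ x in Hb a r, w x ^ (-1 / (p - 1)) ≠ ∞)
    (hAp : ∀ (a : Fin n → ℝ) (r : ℝ), 0 < r → r ≤ 1 →
      (∫⁻ x in Hb a r, w x) * (∫⁻ x in Hb a r, w x ^ (-1 / (p - 1))) ^ (p - 1) ≤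
      ENNReal.ofReal C * volume (Hb a r) ^ p) :
    ∃ δ K : ℝ, 0 < δ ∧ 0 < K ∧ ∀ (a : Fin n → ℝ) (r : ℝ), 0 < r →
      ∫⁻ x in Hb a r, (w x ^ (-1 / (p - 1))) ^ (1 + δ) ≤
        ENNReal.ofReal (K * ((1 + r) / r) ^ (n * δ)) *
          (∫⁻ x in Hb a r, w x ^ (-1 / (p - 1))) ^ (1 + δ) := by
  have hp1 : 0 < p - 1 := by linarith
  set M : ℝ := (2 ^ p * C) ^ (1 / (p - 1)) with hM
  have hMpos : 0 < M := by positivity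
  have hM1 : 1 ≤ M := by
    refine Real.one_le_rpow ?_ (by positivity)
    have : (1 : ℝ) ≤ 2 ^ p := Real.one_le_rpow (by norm_num) (by linarith)
    nlinarith
  set β : ℝ := 1 - 1 / M with hβ
  have hβ0 : 0 ≤ β := by rw [hβ, sub_nonneg, div_le_one hMpos]; exact hM1
  have hβ1 : β < 1 := by rw [hβ]; have : 0 < 1 / M := by positivity
                         linarith
  obtain ⟨δ, hδ0, hδ1, hδ⟩ := exists_delta n hβ1
  set K : ℝ := 4 / (1 - β) with hK
  have hb : 0 < 1 - β := by linarith
  have hK0 : 0 < K := by positivity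
  have hK1 : 1 ≤ K := by rw [hK, le_div_iff₀ hb]; linarith
  have hKK : 2 ^ δ + K * ((2 : ℝ) ^ n * 2) ^ δ * β ≤ K := by
    have h1 : (2 : ℝ) ^ δ ≤ 2 := by
      simpa using Real.rpow_le_rpow_of_exponent_le (by norm_num : (1 : ℝ) ≤ 2) hδ1
    have h2 : K * ((2 : ℝ) ^ n * 2) ^ δ * β ≤ K * ((1 + β) / 2) := by
      rw [mul_assoc]; gcongr
    have h3 : K * (1 - β) = 4 := by rw [hK]; field_simp
    linarith
  have hPP : ∀ m, PP (fun x => w x ^ (-1 / (p - 1))) δ (ENNReal.ofReal K) m := by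
    refine main_step (β := ENNReal.ofReal β) _ hδ0.le hfin ?_ ?_ (by simpa using hK1) ?_
    · intro a r hr h0
      rw [lintegral_eq_zero_iff' (hw.restrict.pow_const _)] at h0
      have h1 : ∀ x, w x ^ (-1 / (p - 1)) ≠ 0 := by
        intro x hx
        rw [ENNReal.rpow_eq_zero_iff] at hx
        rcases hx with ⟨_, h⟩ | ⟨h, _⟩
        · have : -1 / (p - 1) < 0 := by rw [neg_div]; simp [hp1]
          linarith
        · exact hwt x h
      have h2 : ∀ᵐ x ∂(volume.restrict (Hb a r)), False := by
        filter_upwards [h0] with x hx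
        exact h1 x hx
      rw [eventually_false_iff_eq_bot, ae_eq_bot, Measure.restrict_eq_zero] at h2
      exact vol_ne_zero a hr h2
    · intro a r hr hr1 E hE hvE
      exact Ainf w hw hwt hp hC a r hr (hfin a r hr) (hAp a r hr hr1) E hE hvE
    · have := ENNReal.ofReal_le_ofReal hKK
      rw [ENNReal.ofReal_add (by positivity) (by positivity), ENNReal.ofReal_mul (by positivity),
        ENNReal.ofReal_mul (by positivity), ← ENNReal.ofReal_rpow_of_pos (by norm_num),
        ← ENNReal.ofReal_rpow_of_pos (by positivity), ENNReal.ofReal_mul (by positivity),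
        ENNReal.ofReal_pow (by positivity)] at this
      simpa only [ENNReal.ofReal_ofNat] using this
  refine ⟨δ, K * 2 ^ (n * δ), hδ0, by positivity, fun a r hr => ?_⟩
  exact full_RH _ (hw.pow_const _) hδ0.le hfin hPP hK0.le a r hr

end RH

section Final

variable {n : ℕ}

lemma cube_lintegral (x : En n) {r : ℝ} (hr : 0 < r) (g : En n → ℝ≥0∞) :
    ∫⁻ y in cube x r, g y =
      ∫⁻ y in RH.Hb (fun i => x i - r / 2) r, g (WithLp.toLp 2 y) := by
  have hmp := PiLp.volume_preserving_toLp (Fin n)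
  have hemb : MeasurableEmbedding (WithLp.toLp 2 : (Fin n → ℝ) → En n) :=
    (MeasurableEquiv.toLp 2 (Fin n → ℝ)).measurableEmbedding
  rw [← hmp.setLIntegral_comp_preimage_emb hemb g (cube x r),
    setLIntegral_congr (RH.Hb_ae_eq (fun i => x i - r / 2) hr)]
  congr 2
  rw [closedBall_pi _ (by positivity)]
  ext y
  simp only [cube, mem_preimage, mem_ofPred_eq, Real.closedBall_eq_Icc, Set.mem_univ_pi, mem_Icc]
  refine forall_congr' fun i => ?_
  rw [abs_le]
  constructor <;> rintro ⟨h1, h2⟩ <;> constructor <;> linarith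

lemma cube_volume (x : En n) {r : ℝ} (hr : 0 < r) :
    volume (cube x r) = ENNReal.ofReal (r ^ n) := by
  have h := cube_lintegral x hr (fun _ => 1)
  rw [setLIntegral_one, setLIntegral_one, RH.volume_Hb] at h
  rw [h, ENNReal.ofReal_pow hr.le]

lemma cube_volume_ne_zero (x : En n) {r : ℝ} (hr : 0 < r) : volume (cube x r) ≠ 0 := by
  rw [cube_volume x hr]; simp; positivity

lemma D_eq (x : En n) {r : ℝ} (hr : 0 < r) (θ : ℝ) :
    ENNReal.ofReal ((1 + r) ^ θ) * volume (cube x r) = ENNReal.ofReal ((1 + r) ^ θ * r ^ n) := by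
  rw [cube_volume x hr, ENNReal.ofReal_mul (by positivity)]

lemma ap_iff {p : ℝ} (hp : 1 < p) {D : ℝ≥0∞} (hD0 : D ≠ 0) (hDt : D ≠ ∞) (W S C : ℝ≥0∞) :
    (D⁻¹ * W) ^ (1 / p) * (D⁻¹ * S) ^ (1 - 1 / p) ≤ C ↔ W * S ^ (p - 1) ≤ (C * D) ^ p := by
  have hp0 : 0 < p := by linarith
  have hp1 : 0 ≤ p - 1 := by linarith
  rw [← ENNReal.rpow_le_rpow_iff hp0, ENNReal.mul_rpow_of_nonneg _ _ hp0.le, ← ENNReal.rpow_mul,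
    ← ENNReal.rpow_mul, one_div_mul_cancel hp0.ne', ENNReal.rpow_one,
    show (1 - 1 / p) * p = p - 1 by field_simp, ENNReal.mul_rpow_of_nonneg _ _ hp1,
    ENNReal.mul_rpow_of_nonneg _ _ hp0.le,
    show D⁻¹ * W * (D⁻¹ ^ (p - 1) * S ^ (p - 1)) =
      (D⁻¹ * D⁻¹ ^ (p - 1)) * (W * S ^ (p - 1)) by ring]
  have h1 : D⁻¹ * D⁻¹ ^ (p - 1) = (D ^ p)⁻¹ := by
    nth_rw 1 [← ENNReal.rpow_one D⁻¹]
    rw [← ENNReal.rpow_add_of_nonneg _ _ zero_le_one hp1, ← ENNReal.inv_rpow]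
    congr 1; ring
  have hDp0 : D ^ p ≠ 0 := by simp [hD0, hp0.not_gt, ENNReal.rpow_eq_zero_iff]
  have hDpt : D ^ p ≠ ∞ := ENNReal.rpow_ne_top_of_nonneg hp0.le hDt
  rw [h1, mul_comm, ← ENNReal.div_eq_inv_mul.trans (mul_comm _ _),
    ENNReal.div_le_iff hDp0 hDpt]

/-- Product form of the `A_p^θ` condition for `p > 1`. -/
lemma apTheta_iff {p θ : ℝ} (hp : 1 < p) (w : En n → ℝ) :
    ApTheta n p θ w ↔ (∀ x, 0 ≤ w x) ∧ LocallyIntegrable w volume ∧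
      ∃ C > 0, ∀ (x : En n) (r : ℝ), 0 < r →
        (∫⁻ y in cube x r, ENNReal.ofReal (w y)) *
          (∫⁻ y in cube x r, ENNReal.ofReal (w y) ^ (-1 / (p - 1))) ^ (p - 1) ≤
          ENNReal.ofReal ((C * ((1 + r) ^ θ * r ^ n)) ^ p) := by
  unfold ApTheta
  refine and_congr_right fun _ => and_congr_right fun _ => exists_congr fun C =>
    and_congr_right fun hC => forall_congr' fun x => forall_congr' fun r => forall_congr' fun hr => ?_
  have hD : 0 < (1 + r) ^ θ * r ^ n := by positivity
  rw [if_neg (by linarith), D_eq x hr, ap_iff hp (by simp [hD]) (by simp),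
    ← ENNReal.ofReal_mul (le_of_lt hC), ENNReal.ofReal_rpow_of_nonneg (by positivity) (by linarith)]

lemma mono_gt_one {p s θ : ℝ} (hs : 1 < s) (hsp : s < p) (hθ : 0 ≤ θ) (w : En n → ℝ)
    (h : ApTheta n s θ w) : ApTheta n p θ w := by
  have hp : 1 < p := hs.trans hsp
  rw [apTheta_iff hs] at h
  rw [apTheta_iff hp]
  obtain ⟨h1, h2, C, hC, h3⟩ := h
  refine ⟨h1, h2, C ^ (s / p), by positivity, fun x r hr => ?_⟩
  have hs1 : 0 < s - 1 := by linarith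
  have hp1 : 0 < p - 1 := by linarith
  have ht : 1 < (p - 1) / (s - 1) := by rw [one_lt_div hs1]; linarith
  have hwm : AEMeasurable (fun y => ENNReal.ofReal (w y)) (volume : Measure (En n)) :=
    h2.aestronglyMeasurable.aemeasurable.ennreal_ofReal
  have hHo := ENNReal.lintegral_mul_le_Lp_mul_Lq (volume.restrict (cube x r))
    (Real.HolderConjugate.conjExponent ht)
    (f := fun y => ENNReal.ofReal (w y) ^ (-1 / (p - 1))) (g := fun _ => 1)
    (hwm.restrict.pow_const _) aemeasurable_const
  have e1 : ∀ y, (ENNReal.ofReal (w y) ^ (-1 / (p - 1))) ^ ((p - 1) / (s - 1)) =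
      ENNReal.ofReal (w y) ^ (-1 / (s - 1)) := fun y => by
    rw [← ENNReal.rpow_mul]; congr 1; field_simp
  have e2 : 1 / ((p - 1) / (s - 1)).conjExponent * (p - 1) = p - s := by
    rw [Real.conjExponent]
    have : p - s ≠ 0 := by linarith
    have h4 : (p - 1) / (s - 1) - 1 = (p - s) / (s - 1) := by field_simp; ring
    rw [h4]; field_simp
  simp only [e1, Pi.mul_apply, mul_one, ENNReal.one_rpow, setLIntegral_one] at hHo
  have hS : (∫⁻ y in cube x r, ENNReal.ofReal (w y) ^ (-1 / (p - 1))) ^ (p - 1) ≤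
      (∫⁻ y in cube x r, ENNReal.ofReal (w y) ^ (-1 / (s - 1))) ^ (s - 1) *
        volume (cube x r) ^ (p - s) := by
    calc _ ≤ _ := ENNReal.rpow_le_rpow hHo hp1.le
      _ = _ := by
        rw [ENNReal.mul_rpow_of_nonneg _ _ hp1.le, ← ENNReal.rpow_mul, ← ENNReal.rpow_mul, e2,
          show 1 / ((p - 1) / (s - 1)) * (p - 1) = s - 1 by field_simp]
  have hφ : 1 ≤ (1 + r) ^ θ := Real.one_le_rpow (by linarith) hθ
  have hrn : 0 < r ^ n := by positivity
  have hφ0 : 0 < (1 + r) ^ θ := by positivity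
  set D : ℝ := (1 + r) ^ θ * r ^ n with hDdef
  have hD0 : 0 < D := by positivity
  calc _ ≤ (∫⁻ y in cube x r, ENNReal.ofReal (w y)) *
        ((∫⁻ y in cube x r, ENNReal.ofReal (w y) ^ (-1 / (s - 1))) ^ (s - 1) *
        volume (cube x r) ^ (p - s)) := by gcongr
    _ ≤ ENNReal.ofReal ((C * D) ^ s) * volume (cube x r) ^ (p - s) := by
        rw [← mul_assoc]; gcongr; exact h3 x r hr
    _ ≤ ENNReal.ofReal ((C * D) ^ s) * ENNReal.ofReal D ^ (p - s) := by
        rw [cube_volume x hr]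
        gcongr
        exact le_mul_of_one_le_left hrn.le hφ
    _ = _ := by
        rw [ENNReal.ofReal_rpow_of_pos hD0, ← ENNReal.ofReal_mul (by positivity)]
        congr 1
        rw [Real.mul_rpow hC.le hD0.le, Real.mul_rpow (by positivity) hD0.le, ← Real.rpow_mul hC.le,
          mul_assoc, ← Real.rpow_add hD0]
        congr 2
        · field_simp
        · ring

lemma mono_one {p θ : ℝ} (hp : 1 < p) (hθ : 0 ≤ θ) (w : En n → ℝ)
    (h : ApTheta n 1 θ w) : ApTheta n p θ w := by
  rw [apTheta_iff hp]
  obtain ⟨h1, h2, C, hC, h3⟩ := h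
  refine ⟨h1, h2, C ^ (1 / p), by positivity, fun x r hr => ?_⟩
  have h3 := h3 x r hr
  rw [if_pos rfl, D_eq x hr] at h3
  have hp1 : 0 < p - 1 := by linarith
  have hp0 : 0 < p := by linarith
  have hφ : 1 ≤ (1 + r) ^ θ := Real.one_le_rpow (by linarith) hθ
  have hrn : 0 < r ^ n := by positivity
  have hφ0 : 0 < (1 + r) ^ θ := by positivity
  set D : ℝ := (1 + r) ^ θ * r ^ n with hDdef
  have hD0 : 0 < D := by positivity
  set e := essInf (fun y => ENNReal.ofReal (w y)) (volume.restrict (cube x r)) with he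
  have hW : ∫⁻ y in cube x r, ENNReal.ofReal (w y) ≤ ENNReal.ofReal D * (ENNReal.ofReal C * e) := by
    rw [← ENNReal.div_eq_inv_mul, ENNReal.div_le_iff (by simp [hD0]) (by simp)] at h3
    rwa [mul_comm]
  have hS : ∫⁻ y in cube x r, ENNReal.ofReal (w y) ^ (-1 / (p - 1)) ≤
      e ^ (-1 / (p - 1)) * ENNReal.ofReal D := by
    calc _ ≤ ∫⁻ y in cube x r, e ^ (-1 / (p - 1)) := by
          refine lintegral_mono_ae ?_
          filter_upwards [ae_essInf_le (μ := volume.restrict (cube x r))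
            (f := fun y => ENNReal.ofReal (w y))] with y hy
          rw [neg_div, ENNReal.rpow_neg, ENNReal.rpow_neg]
          gcongr
      _ = e ^ (-1 / (p - 1)) * volume (cube x r) := by simp
      _ ≤ _ := by
        rw [cube_volume x hr]
        gcongr
        exact le_mul_of_one_le_left hrn.le hφ
  calc _ ≤ (ENNReal.ofReal D * (ENNReal.ofReal C * e)) *
        (e ^ (-1 / (p - 1)) * ENNReal.ofReal D) ^ (p - 1) := by gcongr
    _ = (e * e⁻¹) * (ENNReal.ofReal C * (ENNReal.ofReal D * ENNReal.ofReal D ^ (p - 1))) := by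
        rw [ENNReal.mul_rpow_of_nonneg _ _ hp1.le, ← ENNReal.rpow_mul,
          show -1 / (p - 1) * (p - 1) = -1 by field_simp, ENNReal.rpow_neg_one]
        ring
    _ ≤ 1 * (ENNReal.ofReal C * (ENNReal.ofReal D * ENNReal.ofReal D ^ (p - 1))) := by
        gcongr; exact ENNReal.mul_inv_le_one e
    _ = _ := by
        rw [one_mul, ENNReal.ofReal_rpow_of_pos hD0, ← ENNReal.ofReal_mul hD0.le,
          ← ENNReal.ofReal_mul hC.le, Real.mul_rpow (by positivity) hD0.le, ← Real.rpow_mul hC.le,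
          one_div_mul_cancel hp0.ne', Real.rpow_one]
        congr 2
        nth_rw 1 [← Real.rpow_one D]
        rw [← Real.rpow_add hD0]
        congr 1; ring

lemma W_ne_top (w : En n → ℝ) (h2 : LocallyIntegrable w volume) (x : En n) {r : ℝ} :
    ∫⁻ y in cube x r, ENNReal.ofReal (w y) ≠ ∞ := by
  have hsub : cube x r ⊆ (WithLp.toLp 2 : (Fin n → ℝ) → En n) ''
      Icc (fun i => x i - r / 2) (fun i => x i + r / 2) := by
    intro y hy
    refine ⟨y.ofLp, ?_, rfl⟩
    simp only [cube, mem_ofPred_eq, abs_le] at hy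
    exact ⟨fun i => by linarith [(hy i).1], fun i => by linarith [(hy i).2]⟩
  have hcomp : IsCompact ((WithLp.toLp 2 : (Fin n → ℝ) → En n) ''
      Icc (fun i => x i - r / 2) (fun i => x i + r / 2)) :=
    isCompact_Icc.image (PiLp.continuous_toLp 2 _)
  have hi := (h2.integrableOn_isCompact hcomp).mono_set hsub
  exact hi.lintegral_lt_top.ne

lemma improve {p θ : ℝ} (hp : 1 < p) (hθ : 0 ≤ θ) (w : En n → ℝ) (h : ApTheta n p θ w) :
    ∃ ε, 0 < ε ∧ ε < p - 1 ∧ ∃ θ' ≥ 0, ApTheta n (p - ε) θ' w := by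
  have hp1 : 0 < p - 1 := by linarith
  have hp0 : 0 < p := by linarith
  rw [apTheta_iff hp] at h
  obtain ⟨h1, h2, C, hC, h3⟩ := h
  by_cases hz : ∀ (x : En n) (r : ℝ), 0 < r → ∫⁻ y in cube x r, ENNReal.ofReal (w y) = 0
  · refine ⟨(p - 1) / 2, by linarith, by linarith, 0, le_rfl, ?_⟩
    rw [apTheta_iff (by linarith)]
    refine ⟨h1, h2, 1, one_pos, fun x r hr => ?_⟩
    rw [hz x r hr, zero_mul]
    exact zero_le
  push Not at hz
  obtain ⟨x₀, r₀, hr₀, hx₀⟩ := hz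
  have hfin : ∀ (x : En n) (r : ℝ), 0 < r →
      ∫⁻ y in cube x r, ENNReal.ofReal (w y) ^ (-1 / (p - 1)) ≠ ∞ := by
    intro x r hr
    set R : ℝ := r₀ + r + 2 * ‖x - x₀‖ with hR
    have hRpos : 0 < R := by positivity
    have hsub0 : cube x₀ r₀ ⊆ cube x₀ R := by
      intro y hy i
      have := hy i
      have := norm_nonneg (x - x₀)
      linarith
    have hsub : cube x r ⊆ cube x₀ R := by
      intro y hy i
      have h4 := hy i
      have h5 : |x i - x₀ i| ≤ ‖x - x₀‖ := by
        have := PiLp.norm_apply_le (x - x₀) i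
        simpa using this
      have h6 := abs_sub_le (y i) (x i) (x₀ i)
      linarith
    have hW : ∫⁻ y in cube x₀ R, ENNReal.ofReal (w y) ≠ 0 := fun h0 =>
      hx₀ (le_antisymm (h0 ▸ lintegral_mono_set hsub0) (zero_le))
    intro htop
    have hS : ∫⁻ y in cube x₀ R, ENNReal.ofReal (w y) ^ (-1 / (p - 1)) = ∞ :=
      top_le_iff.1 (htop ▸ lintegral_mono_set hsub)
    have := h3 x₀ R hRpos
    rw [hS, ENNReal.top_rpow_of_pos hp1, ENNReal.mul_top hW] at this
    exact ENNReal.ofReal_ne_top (top_le_iff.1 this)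
  -- transfer to boxes
  set v : (Fin n → ℝ) → ℝ≥0∞ := fun y => ENNReal.ofReal (w (WithLp.toLp 2 y)) with hv
  have hvm : AEMeasurable v volume := by
    have := h2.aestronglyMeasurable.aemeasurable.ennreal_ofReal
    exact this.comp_quasiMeasurePreserving
      (PiLp.volume_preserving_toLp (Fin n)).quasiMeasurePreserving
  have hbox : ∀ (a : Fin n → ℝ) (r : ℝ), 0 < r → ∀ g : En n → ℝ≥0∞,
      ∫⁻ y in RH.Hb a r, g (WithLp.toLp 2 y) =
        ∫⁻ y in cube (WithLp.toLp 2 fun i => a i + r / 2) r, g y := by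
    intro a r hr g
    rw [cube_lintegral _ hr]
    simp
  have hCl : ∀ (a : Fin n → ℝ) (r : ℝ), 0 < r → r ≤ 1 →
      (∫⁻ x in RH.Hb a r, v x) * (∫⁻ x in RH.Hb a r, v x ^ (-1 / (p - 1))) ^ (p - 1) ≤
      ENNReal.ofReal (max 1 ((C * 2 ^ θ) ^ p)) * volume (RH.Hb a r) ^ p := by
    intro a r hr hr1
    have h4 := h3 (WithLp.toLp 2 fun i => a i + r / 2) r hr
    rw [← hbox a r hr, ← hbox a r hr (fun y => ENNReal.ofReal (w y) ^ (-1 / (p - 1)))] at h4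
    refine h4.trans ?_
    rw [RH.volume_Hb, ← ENNReal.ofReal_pow hr.le,
      ENNReal.ofReal_rpow_of_nonneg (by positivity) hp0.le, ← ENNReal.ofReal_mul (by positivity)]
    refine ENNReal.ofReal_le_ofReal ?_
    rw [← mul_assoc, Real.mul_rpow (by positivity) (by positivity)]
    gcongr
    refine le_trans ?_ (le_max_right _ _)
    gcongr
    linarith
  obtain ⟨δ, K, hδ, hK, hRH⟩ := RH.box_RH v hvm (fun _ => ENNReal.ofReal_ne_top) hp
    (le_max_left _ _) (fun a r hr => by
      have := hfin (WithLp.toLp 2 fun i => a i + r / 2) r hr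
      rwa [← hbox a r hr (fun y => ENNReal.ofReal (w y) ^ (-1 / (p - 1)))] at this) hCl
  set q : ℝ := 1 + (p - 1) / (1 + δ) with hq
  have hq1 : 0 < q - 1 := by rw [hq]; simp; positivity
  have hqd : (1 + δ) * (q - 1) = p - 1 := by rw [hq]; field_simp; ring
  have hqp : q < p := by nlinarith
  have hq0 : 0 < q := by linarith
  refine ⟨p - q, by linarith, by linarith, n * δ + θ * p, by positivity, ?_⟩
  rw [show p - (p - q) = q by ring, apTheta_iff (by linarith)]
  refine ⟨h1, h2, (K ^ (q - 1) * C ^ p) ^ (1 / q), by positivity, fun x r hr => ?_⟩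
  have h4 := hRH (fun i => x i - r / 2) r hr
  simp only [hv] at h4
  rw [← cube_lintegral x hr (fun y => ENNReal.ofReal (w y) ^ (-1 / (p - 1))),
    ← cube_lintegral x hr (fun y => (ENNReal.ofReal (w y) ^ (-1 / (p - 1))) ^ (1 + δ))] at h4
  have e1 : ∀ y, (ENNReal.ofReal (w y) ^ (-1 / (p - 1))) ^ (1 + δ) =
      ENNReal.ofReal (w y) ^ (-1 / (q - 1)) := fun y => by
    rw [← ENNReal.rpow_mul]; congr 1; rw [← hqd]; field_simp
  simp only [e1] at h4
  have hφ : 1 ≤ 1 + r := by linarith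
  have hφ0 : 0 < 1 + r := by linarith
  calc _ ≤ (∫⁻ y in cube x r, ENNReal.ofReal (w y)) *
        (ENNReal.ofReal (K * ((1 + r) / r) ^ (n * δ)) *
          (∫⁻ y in cube x r, ENNReal.ofReal (w y) ^ (-1 / (p - 1))) ^ (1 + δ)) ^ (q - 1) := by gcongr
    _ = ENNReal.ofReal ((K * ((1 + r) / r) ^ (n * δ)) ^ (q - 1)) *
        ((∫⁻ y in cube x r, ENNReal.ofReal (w y)) *
          (∫⁻ y in cube x r, ENNReal.ofReal (w y) ^ (-1 / (p - 1))) ^ (p - 1)) := by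
        rw [ENNReal.mul_rpow_of_nonneg _ _ hq1.le, ← ENNReal.rpow_mul, hqd,
          ENNReal.ofReal_rpow_of_pos (by positivity)]
        ring
    _ ≤ ENNReal.ofReal ((K * ((1 + r) / r) ^ (n * δ)) ^ (q - 1)) *
        ENNReal.ofReal ((C * ((1 + r) ^ θ * r ^ n)) ^ p) := by gcongr; exact h3 x r hr
    _ ≤ _ := by
        rw [← ENNReal.ofReal_mul (by positivity)]
        refine ENNReal.ofReal_le_ofReal ?_
        have hrn : r ^ n = r ^ (n : ℝ) := (Real.rpow_natCast r n).symm
        have l1 : (K * ((1 + r) / r) ^ (n * δ)) ^ (q - 1) * (C * ((1 + r) ^ θ * r ^ n)) ^ p =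
            K ^ (q - 1) * C ^ p * ((1 + r) ^ (n * δ * (q - 1) + θ * p) * r ^ (n * q)) := by
          rw [hrn, Real.mul_rpow hK.le (by positivity), Real.div_rpow hφ0.le hr.le,
            Real.div_rpow (by positivity) (by positivity), Real.mul_rpow hC.le (by positivity),
            Real.mul_rpow (by positivity) (by positivity), ← Real.rpow_mul hφ0.le,
            ← Real.rpow_mul hφ0.le, ← Real.rpow_mul hr.le, ← Real.rpow_mul hr.le,
            Real.rpow_add hφ0, show (n : ℝ) * q = n * p - n * δ * (q - 1) by
              linear_combination (n : ℝ) * hqd, Real.rpow_sub hr]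
          field_simp
        have l2 : ((K ^ (q - 1) * C ^ p) ^ (1 / q) * ((1 + r) ^ (n * δ + θ * p) * r ^ n)) ^ q =
            K ^ (q - 1) * C ^ p * ((1 + r) ^ ((n * δ + θ * p) * q) * r ^ (n * q)) := by
          rw [hrn, Real.mul_rpow (by positivity) (by positivity), ← Real.rpow_mul (by positivity),
            one_div_mul_cancel hq0.ne', Real.rpow_one, Real.mul_rpow (by positivity) (by positivity),
            ← Real.rpow_mul hφ0.le, ← Real.rpow_mul hr.le]
        rw [l1, l2]
        have hle : n * δ * (q - 1) + θ * p ≤ (n * δ + θ * p) * q := by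
          have a1 : 0 ≤ n * δ := by positivity
          have a2 : 0 ≤ θ * p := by positivity
          nlinarith
        gcongr

end Final

/-- Lemma 2.1(ii): openness of `A_p^∞(φ)`: if `ω ∈ A_p^∞(φ)` with `p > 1` then
`ω ∈ A_{p-ε}^∞(φ)` for some `0 < ε < p - 1`; consequently
`A_p^∞(φ) = ∪_{1 ≤ q < p} A_q^∞(φ)`. -/
theorem stmt8 (n : ℕ) (hn : 0 < n) (p : ℝ) (hp : 1 < p) (ω : En n → ℝ)
    (hω : ∃ θ ≥ 0, ApTheta n p θ ω) :
    (∃ ε, 0 < ε ∧ ε < p - 1 ∧ ∃ θ' ≥ 0, ApTheta n (p - ε) θ' ω) ∧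
      (∀ w : En n → ℝ, (∃ θ ≥ 0, ApTheta n p θ w) ↔
        ∃ s, 1 ≤ s ∧ s < p ∧ ∃ θ' ≥ 0, ApTheta n s θ' w) := by
  refine ⟨?_, fun w => ⟨?_, ?_⟩⟩
  · obtain ⟨θ, hθ, h⟩ := hω
    exact improve hp hθ ω h
  · rintro ⟨θ, hθ, h⟩
    obtain ⟨ε, h1, h2, h3⟩ := improve hp hθ w h
    exact ⟨p - ε, by linarith, by linarith, h3⟩
  · rintro ⟨s, hs1, hsp, θ, hθ, h⟩
    rcases hs1.eq_or_lt with rfl | hs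
    · exact ⟨θ, hθ, mono_one hp hθ w h⟩
    · exact ⟨θ, hθ, mono_gt_one hs hsp hθ w h⟩

end
end

section
/- If ω ∈ A_p^∞(φ) for some p ≥ 1, then there exist positive numbers l, δ and C such that for all cubes Q = Q(x₀,r), (|Q|^{-1} ∫_Q ω^{1+δ})^{1/(1+δ)} ≤ C (|Q|^{-1} ∫_Q ω) (1+r)^l. -/
open MeasureTheory ENNReal Set Filter

noncomputable section

/-- Half-open cube with lower corner `c` and side `r`. -/
def hq {n : ℕ} (c : Fin n → ℝ) (r : ℝ) : Set (Fin n → ℝ) :=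
  Set.pi univ fun i => Ico (c i) (c i + r)

/-- Corner of a subcube. -/
def subc {n N : ℕ} (c : Fin n → ℝ) (s : ℝ) (k : Fin n → Fin N) : Fin n → ℝ :=
  fun i => c i + s * ((k i : ℕ) : ℝ)

lemma mem_hq {n : ℕ} {c : Fin n → ℝ} {r : ℝ} {x : Fin n → ℝ} :
    x ∈ hq c r ↔ ∀ i, c i ≤ x i ∧ x i < c i + r := by
  simp [hq]

lemma measurableSet_hq {n : ℕ} (c : Fin n → ℝ) (r : ℝ) : MeasurableSet (hq c r) :=
  MeasurableSet.univ_pi fun _ => measurableSet_Ico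

lemma volume_hq {n : ℕ} (c : Fin n → ℝ) (r : ℝ) :
    volume (hq c r) = ENNReal.ofReal r ^ n := by
  unfold hq
  rw [Real.volume_pi_Ico]
  simp

lemma volume_hq_ne_top {n : ℕ} (c : Fin n → ℝ) (r : ℝ) : volume (hq c r) ≠ ∞ := by
  rw [volume_hq]; exact ENNReal.pow_ne_top ofReal_ne_top

lemma volume_hq_ne_zero {n : ℕ} (c : Fin n → ℝ) {r : ℝ} (hr : 0 < r) :
    volume (hq c r) ≠ 0 := by
  rw [volume_hq]; exact pow_ne_zero _ (by simpa using hr)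

lemma hq_split {n N : ℕ} (c : Fin n → ℝ) {s : ℝ} (hs : 0 < s) :
    hq c (N * s) = ⋃ k : Fin n → Fin N, hq (subc c s k) s := by
  ext x
  simp only [mem_iUnion, mem_hq, subc]
  constructor
  · intro h
    have h0 : ∀ i, 0 ≤ (x i - c i) / s := fun i =>
      div_nonneg (by linarith [(h i).1]) hs.le
    have h1 : ∀ i, ⌊(x i - c i) / s⌋₊ < N := fun i => by
      rw [Nat.floor_lt (h0 i), div_lt_iff₀ hs]
      linarith [(h i).2]
    refine ⟨fun i => ⟨_, h1 i⟩, fun i => ?_⟩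
    have a := Nat.floor_le (h0 i)
    have b := Nat.lt_floor_add_one ((x i - c i) / s)
    rw [le_div_iff₀ hs] at a
    rw [div_lt_iff₀ hs] at b
    constructor <;> simp only <;> nlinarith
  · rintro ⟨k, h⟩ i
    have h2 : ((k i : ℕ) : ℝ) + 1 ≤ N := by exact_mod_cast (k i).2
    have h3 : (0 : ℝ) ≤ ((k i : ℕ) : ℝ) := by positivity
    constructor
    · nlinarith [(h i).1]
    · nlinarith [(h i).2]

lemma hq_disj {n N : ℕ} (c : Fin n → ℝ) {s : ℝ} (hs : 0 < s) :
    Pairwise (Function.onFun Disjoint fun k : Fin n → Fin N => hq (subc c s k) s) := by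
  intro k l hkl
  refine Set.disjoint_left.2 fun x hx hy => hkl ?_
  rw [mem_hq] at hx hy
  funext i
  have a := hx i
  have b := hy i
  simp only [subc] at a b
  ext
  have h1 : ((k i : ℕ) : ℝ) < (l i : ℕ) + 1 := by
    by_contra hh
    push Not at hh
    nlinarith
  have h2 : ((l i : ℕ) : ℝ) < (k i : ℕ) + 1 := by
    by_contra hh
    push Not at hh
    nlinarith
  have h1' : (k i : ℕ) < (l i : ℕ) + 1 := by exact_mod_cast h1
  have h2' : (l i : ℕ) < (k i : ℕ) + 1 := by exact_mod_cast h2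
  omega

lemma lint_split {n N : ℕ} (c : Fin n → ℝ) {s : ℝ} (hs : 0 < s)
    (g : (Fin n → ℝ) → ℝ≥0∞) :
    ∫⁻ x in hq c (N * s), g x = ∑ k : Fin n → Fin N, ∫⁻ x in hq (subc c s k) s, g x := by
  rw [hq_split c hs, lintegral_iUnion (fun k => measurableSet_hq _ _) (hq_disj c hs),
    tsum_fintype]

lemma lint_split2 {n : ℕ} (c : Fin n → ℝ) {r : ℝ} (hr : 0 < r)
    (g : (Fin n → ℝ) → ℝ≥0∞) :
    ∫⁻ x in hq c r, g x =
      ∑ k : Fin n → Fin 2, ∫⁻ x in hq (subc c (r / 2) k) (r / 2), g x := by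
  rw [← lint_split c (half_pos hr) g]
  congr 3
  push_cast; ring

lemma sub_hq2 {n : ℕ} (c : Fin n → ℝ) {r : ℝ} (hr : 0 < r) (k : Fin n → Fin 2) :
    hq (subc c (r / 2) k) (r / 2) ⊆ hq c r := by
  have := hq_split (N := 2) c (half_pos hr)
  have e : ((2 : ℕ) : ℝ) * (r / 2) = r := by push_cast; ring
  rw [e] at this
  rw [this]
  exact subset_iUnion (fun k : Fin n → Fin 2 => hq (subc c (r / 2) k) (r / 2)) k

/-- average on a half-open cube -/
def av {n : ℕ} (f : (Fin n → ℝ) → ℝ≥0∞) (c : Fin n → ℝ) (r : ℝ) : ℝ≥0∞ :=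
  (∫⁻ x in hq c r, f x) / volume (hq c r)

/-- dyadic conditional expectation of generation `N` relative to the cube `hq c r`. -/
def WW {n : ℕ} (f : (Fin n → ℝ) → ℝ≥0∞) : ℕ → (Fin n → ℝ) → ℝ → (Fin n → ℝ) → ℝ≥0∞
  | 0, c, r, _ => av f c r
  | N + 1, c, r, x => ∑ k : Fin n → Fin 2,
      (hq (subc c (r / 2) k) (r / 2)).indicator (WW f N (subc c (r / 2) k) (r / 2)) x

lemma WW_meas {n : ℕ} (f : (Fin n → ℝ) → ℝ≥0∞) (N : ℕ) :
    ∀ c r, Measurable (WW f N c r) := by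
  induction N with
  | zero => intro c r; exact measurable_const
  | succ N ih =>
    intro c r
    change Measurable fun x => ∑ k : Fin n → Fin 2,
      (hq (subc c (r / 2) k) (r / 2)).indicator (WW f N (subc c (r / 2) k) (r / 2)) x
    exact Finset.measurable_sum _ fun k _ => (ih _ _).indicator (measurableSet_hq _ _)

lemma WW_succ {n : ℕ} (f : (Fin n → ℝ) → ℝ≥0∞) (N : ℕ) (c : Fin n → ℝ) {r : ℝ} (hr : 0 < r)
    (k : Fin n → Fin 2) {x : Fin n → ℝ} (hx : x ∈ hq (subc c (r / 2) k) (r / 2)) :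
    WW f (N + 1) c r x = WW f N (subc c (r / 2) k) (r / 2) x := by
  unfold WW
  rw [Finset.sum_eq_single k]
  · rw [indicator_of_mem hx]
    cases N <;> rfl
  · intro l _ hl
    rw [indicator_of_notMem]
    exact fun h => Set.disjoint_left.1 (hq_disj c (half_pos hr) hl) h hx
  · simp

lemma WW_eq_av {n : ℕ} (f : (Fin n → ℝ) → ℝ≥0∞) (N : ℕ) :
    ∀ (c : Fin n → ℝ) (r : ℝ), 0 < r → ∀ x ∈ hq c r,
      ∃ c', x ∈ hq c' (r / 2 ^ N) ∧ WW f N c r x = av f c' (r / 2 ^ N) := by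
  induction N with
  | zero => intro c r hr x hx; exact ⟨c, by simpa using hx, by simp [WW]⟩
  | succ N ih =>
    intro c r hr x hx
    have := hq_split (N := 2) c (half_pos hr)
    have e : ((2 : ℕ) : ℝ) * (r / 2) = r := by push_cast; ring
    rw [e] at this
    rw [this] at hx
    obtain ⟨k, hk⟩ := mem_iUnion.1 hx
    obtain ⟨c', h1, h2⟩ := ih _ _ (half_pos hr) x hk
    have e2 : r / 2 / 2 ^ N = r / 2 ^ (N + 1) := by field_simp; ring
    rw [e2] at h1 h2
    exact ⟨c', h1, by rw [WW_succ f N c hr k hk, h2]⟩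

lemma av_child {n : ℕ} (f : (Fin n → ℝ) → ℝ≥0∞) (c : Fin n → ℝ) {r : ℝ} (hr : 0 < r)
    (k : Fin n → Fin 2) : av f (subc c (r / 2) k) (r / 2) ≤ 2 ^ n * av f c r := by
  have e : volume (hq c r) = 2 ^ n * volume (hq (subc c (r / 2) k) (r / 2)) := by
    rw [volume_hq, volume_hq, ← mul_pow]
    congr 1
    rw [show (2 : ℝ≥0∞) = ENNReal.ofReal 2 by simp, ← ENNReal.ofReal_mul (by norm_num)]
    congr 1; ring
  unfold av
  rw [e, ← mul_div_assoc, ENNReal.mul_div_mul_left _ _ (by simp) (by simp)]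
  gcongr
  exact sub_hq2 c hr k

lemma stopL {n : ℕ} (f : (Fin n → ℝ) → ℝ≥0∞)
    (δ : ℝ) (hδ : 0 < δ) (A t : ℝ≥0∞) (M : ℕ)
    (hA : ∀ N ≤ M, ∀ (c : Fin n → ℝ) (r : ℝ), 0 < r → r ≤ 1 →
      ∫⁻ x in hq c r, WW f N c r x ^ (1 + δ) ≤ A * av f c r ^ δ * ∫⁻ x in hq c r, f x)
    (N : ℕ) : N ≤ M + 1 → ∀ (c : Fin n → ℝ) (r : ℝ), 0 < r → r ≤ 1 → av f c r ≤ t →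
      ∃ E ⊆ hq c r, MeasurableSet E ∧ t * volume E ≤ ∫⁻ x in E, f x ∧
        ∫⁻ x in hq c r, WW f N c r x ^ (1 + δ) ≤
          t ^ δ * (∫⁻ x in hq c r, f x) + A * (2 ^ n * t) ^ δ * ∫⁻ x in E, f x := by
  induction N with
  | zero =>
    intro _ c r hr hr1 hav
    refine ⟨∅, empty_subset _, MeasurableSet.empty, by simp, ?_⟩
    simp only [WW, lintegral_const, Measure.restrict_apply MeasurableSet.univ, univ_inter]
    have : av f c r * volume (hq c r) = ∫⁻ x in hq c r, f x :=
      ENNReal.div_mul_cancel (volume_hq_ne_zero c hr) (volume_hq_ne_top c r)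
    rw [add_comm, ENNReal.rpow_add_of_nonneg _ _ hδ.le zero_le_one, ENNReal.rpow_one, mul_assoc,
      this]
    refine le_trans ?_ le_self_add
    gcongr
  | succ N ih =>
    intro hN c r hr hr1 hav
    have key : ∀ k : Fin n → Fin 2, ∃ E ⊆ hq (subc c (r / 2) k) (r / 2), MeasurableSet E ∧
        t * volume E ≤ ∫⁻ x in E, f x ∧
        ∫⁻ x in hq (subc c (r / 2) k) (r / 2), WW f (N + 1) c r x ^ (1 + δ) ≤
          t ^ δ * (∫⁻ x in hq (subc c (r / 2) k) (r / 2), f x)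
            + A * (2 ^ n * t) ^ δ * ∫⁻ x in E, f x := by
      intro k
      have e : ∫⁻ x in hq (subc c (r / 2) k) (r / 2), WW f (N + 1) c r x ^ (1 + δ) =
          ∫⁻ x in hq (subc c (r / 2) k) (r / 2),
            WW f N (subc c (r / 2) k) (r / 2) x ^ (1 + δ) :=
        setLIntegral_congr_fun (measurableSet_hq _ _) fun x hx => by
          simp only [WW_succ f N c hr k hx]
      rw [e]
      by_cases h : av f (subc c (r / 2) k) (r / 2) ≤ t
      · exact ih (by omega) _ _ (half_pos hr) (by linarith) h
      · push Not at h
        refine ⟨_, subset_rfl, measurableSet_hq _ _, ?_, ?_⟩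
        · exact (ENNReal.le_div_iff_mul_le (Or.inl (volume_hq_ne_zero _ (half_pos hr)))
            (Or.inl (volume_hq_ne_top _ _))).1 h.le
        · refine (hA N (by omega) _ _ (half_pos hr) (by linarith)).trans ?_
          refine le_trans ?_ le_add_self
          gcongr
          exact (av_child f c hr k).trans (by gcongr)
    choose E hE1 hE2 hE3 hE4 using key
    have hd : Pairwise (Function.onFun Disjoint E) := fun k l hkl =>
      (hq_disj c (half_pos hr) hkl).mono (hE1 k) (hE1 l)
    refine ⟨⋃ k, E k, iUnion_subset fun k => (hE1 k).trans (sub_hq2 c hr k),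
      MeasurableSet.iUnion hE2, ?_, ?_⟩
    · rw [measure_iUnion hd hE2, lintegral_iUnion hE2 hd, tsum_fintype, tsum_fintype,
        Finset.mul_sum]
      exact Finset.sum_le_sum fun k _ => hE3 k
    · rw [lint_split2 c hr, lint_split2 c hr f, lintegral_iUnion hE2 hd, tsum_fintype,
        Finset.mul_sum, Finset.mul_sum, ← Finset.sum_add_distrib]
      exact Finset.sum_le_sum fun k _ => hE4 k

lemma stepN {n : ℕ} (f : (Fin n → ℝ) → ℝ≥0∞)
    (hfin : ∀ c r, ∫⁻ x in hq c r, f x ≠ ∞)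
    (δ : ℝ) (hδ : 0 < δ) (A β : ℝ≥0∞) (hA1 : 1 ≤ A)
    (hA2 : 2 ^ δ + A * (2 ^ n * 2) ^ δ * β ≤ A)
    (hβ : ∀ (c : Fin n → ℝ) (r : ℝ), 0 < r → r ≤ 1 → ∀ E ⊆ hq c r, MeasurableSet E →
      2 * volume E ≤ volume (hq c r) → ∫⁻ x in E, f x ≤ β * ∫⁻ x in hq c r, f x)
    (N : ℕ) : ∀ (c : Fin n → ℝ) (r : ℝ), 0 < r → r ≤ 1 →
      ∫⁻ x in hq c r, WW f N c r x ^ (1 + δ) ≤ A * av f c r ^ δ * ∫⁻ x in hq c r, f x := by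
  induction N using Nat.strong_induction_on with
  | _ N ih =>
  intro c r hr hr1
  have hav : av f c r * volume (hq c r) = ∫⁻ x in hq c r, f x :=
    ENNReal.div_mul_cancel (volume_hq_ne_zero c hr) (volume_hq_ne_top c r)
  rcases N with _ | N
  · simp only [WW, lintegral_const, Measure.restrict_apply MeasurableSet.univ, univ_inter]
    rw [add_comm, ENNReal.rpow_add_of_nonneg _ _ hδ.le zero_le_one, ENNReal.rpow_one, mul_assoc,
      hav]
    gcongr
    calc av f c r ^ δ = 1 * av f c r ^ δ := (one_mul _).symm
      _ ≤ _ := by gcongr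
  · obtain ⟨E, hE1, hE2, hE3, hE4⟩ := stopL f δ hδ A (2 * av f c r) N
      (fun K hK => ih K (by omega)) (N + 1) le_rfl c r hr hr1
      (by rw [two_mul]; exact le_self_add)
    refine hE4.trans ?_
    have hEf : ∫⁻ x in E, f x ≤ ∫⁻ x in hq c r, f x := lintegral_mono_set hE1
    by_cases h0 : ∫⁻ x in hq c r, f x = 0
    · have : ∫⁻ x in E, f x = 0 := le_antisymm (hEf.trans h0.le) zero_le
      rw [h0, this]; simp
    have hav0 : av f c r ≠ 0 := fun h => h0 (by rw [← hav, h, zero_mul])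
    have havt : av f c r ≠ ∞ := ENNReal.div_ne_top (hfin c r) (volume_hq_ne_zero c hr)
    have hE5 : 2 * volume E ≤ volume (hq c r) := by
      have h1 := hE3.trans hEf
      rw [← hav, mul_comm 2, mul_assoc] at h1
      exact (ENNReal.mul_le_mul_iff_right hav0 havt).1 h1
    have hE6 := hβ c r hr hr1 E hE1 hE2 hE5
    calc (2 * av f c r) ^ δ * (∫⁻ x in hq c r, f x)
          + A * (2 ^ n * (2 * av f c r)) ^ δ * ∫⁻ x in E, f x
        ≤ (2 * av f c r) ^ δ * (∫⁻ x in hq c r, f x)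
          + A * (2 ^ n * (2 * av f c r)) ^ δ * (β * ∫⁻ x in hq c r, f x) := by gcongr
      _ = (2 ^ δ + A * (2 ^ n * 2) ^ δ * β) * av f c r ^ δ * ∫⁻ x in hq c r, f x := by
          rw [← mul_assoc (2 ^ n) 2, ENNReal.mul_rpow_of_nonneg _ _ hδ.le,
            ENNReal.mul_rpow_of_nonneg _ (av f c r) hδ.le]
          ring
      _ ≤ _ := by gcongr

lemma hq_ae_ball {n : ℕ} (c : Fin n → ℝ) {r : ℝ} (hr : 0 < r) :
    hq c r =ᵐ[volume] Metric.closedBall (fun i => c i + r / 2) (r / 2) := by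
  have h1 : Metric.closedBall (fun i => c i + r / 2) (r / 2) = Icc c (fun i => c i + r) := by
    rw [← pi_univ_Icc, closedBall_pi _ (half_pos hr).le]
    congr 1
    funext i
    rw [Real.closedBall_eq_Icc]
    congr 1 <;> ring
  rw [h1]
  exact Measure.univ_pi_Ico_ae_eq_Icc

lemma WW_tendsto {n : ℕ} (f : (Fin n → ℝ) → ℝ≥0∞) (hf : Measurable f)
    (hfin : ∀ c r, ∫⁻ x in hq c r, f x ≠ ∞) (c : Fin n → ℝ) {r : ℝ} (hr : 0 < r) :
    ∀ᵐ x ∂(volume.restrict (hq c r)),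
      Tendsto (fun N => WW f N c r x) atTop (nhds (f x)) := by
  let ρ : Measure (Fin n → ℝ) := volume.withDensity f
  have : IsLocallyFiniteMeasure ρ := by
    refine ⟨fun x => ⟨hq (fun i => x i - 1) 2, ?_, ?_⟩⟩
    · refine mem_of_superset (Metric.ball_mem_nhds x one_pos) fun y hy => ?_
      rw [mem_hq]
      intro i
      have := (dist_le_pi_dist y x i).trans_lt hy
      rw [Real.dist_eq, abs_lt] at this
      constructor <;> linarith
    · rw [withDensity_apply _ (measurableSet_hq _ _)]
      exact (hfin _ _).lt_top
  have h1 := VitaliFamily.ae_tendsto_rnDeriv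
    (IsUnifLocDoublingMeasure.vitaliFamily (volume : Measure (Fin n → ℝ)) 1) ρ
  have h2 := Measure.rnDeriv_withDensity (volume : Measure (Fin n → ℝ)) hf
  rw [ae_restrict_iff' (measurableSet_hq _ _)]
  filter_upwards [h1, h2] with x hx1 hx2 hx
  rw [show ρ.rnDeriv volume x = f x from hx2] at hx1
  choose c' hc1 hc2 using fun N => WW_eq_av f N c r hr x hx
  have hpos : ∀ N : ℕ, 0 < r / 2 ^ N := fun N => by positivity
  have hlim : Tendsto (fun N : ℕ => r / 2 ^ N / 2) atTop (nhdsWithin 0 (Ioi 0)) := by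
    refine tendsto_nhdsWithin_iff.2 ⟨?_, Eventually.of_forall fun N => half_pos (hpos N)⟩
    have := (tendsto_pow_atTop_nhds_zero_of_lt_one (r := (1 / 2 : ℝ)) (by norm_num)
      (by norm_num)).const_mul (r / 2)
    rw [mul_zero] at this
    refine this.congr fun N => ?_
    rw [div_pow, one_pow]; ring
  have h3 := IsUnifLocDoublingMeasure.tendsto_closedBall_filterAt
    (volume : Measure (Fin n → ℝ)) (K := 1) (x := x)
    (fun N i => c' N i + r / 2 ^ N / 2) (fun N => r / 2 ^ N / 2) hlim
    (Eventually.of_forall fun N => by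
      rw [one_mul, mem_closedBall_iff_norm, pi_norm_le_iff_of_nonneg (half_pos (hpos N)).le]
      intro i
      have := mem_hq.1 (hc1 N) i
      rw [Pi.sub_apply, Real.norm_eq_abs, abs_le]
      constructor <;> linarith)
  refine (hx1.comp h3).congr fun N => ?_
  rw [hc2 N]
  have e := hq_ae_ball (c' N) (hpos N)
  have e' : hq (c' N) (r / 2 ^ N) =ᵐ[ρ] _ := (withDensity_absolutelyContinuous _ f).ae_le e
  simp only [Function.comp, av]
  rw [← measure_congr e, ← measure_congr e', withDensity_apply _ (measurableSet_hq _ _)]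

lemma coreRH {n : ℕ} (f : (Fin n → ℝ) → ℝ≥0∞) (hf : Measurable f)
    (hfin : ∀ c r, ∫⁻ x in hq c r, f x ≠ ∞)
    (β : ℝ) (hβ0 : 0 ≤ β) (hβ1 : β < 1)
    (hβ : ∀ (c : Fin n → ℝ) (r : ℝ), 0 < r → r ≤ 1 → ∀ E ⊆ hq c r, MeasurableSet E →
      2 * volume E ≤ volume (hq c r) →
        ∫⁻ x in E, f x ≤ ENNReal.ofReal β * ∫⁻ x in hq c r, f x) :
    ∃ δ : ℝ, δ > 0 ∧ ∃ A : ℝ, A > 0 ∧ ∀ (c : Fin n → ℝ) (r : ℝ), 0 < r → r ≤ 1 →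
      ∫⁻ x in hq c r, f x ^ (1 + δ) ≤
        ENNReal.ofReal A * av f c r ^ δ * ∫⁻ x in hq c r, f x := by
  obtain ⟨δ, hδ, hδ2⟩ : ∃ δ : ℝ, δ > 0 ∧ ((2 : ℝ) ^ n * 2) ^ δ * β ≤ (1 + β) / 2 := by
    have hc : Tendsto (fun δ : ℝ => ((2 : ℝ) ^ n * 2) ^ δ * β) (nhds 0) (nhds (1 * β)) := by
      refine Tendsto.mul_const _ ?_
      have := (Real.continuous_const_rpow (a := (2 : ℝ) ^ n * 2) (by positivity)).tendsto 0
      simpa using this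
    have h1 : ∀ᶠ δ in nhdsWithin (0 : ℝ) (Ioi 0), ((2 : ℝ) ^ n * 2) ^ δ * β < (1 + β) / 2 :=
      (hc.mono_left nhdsWithin_le_nhds).eventually (gt_mem_nhds (by linarith))
    obtain ⟨δ, h, h'⟩ := (h1.and self_mem_nhdsWithin).exists
    exact ⟨δ, h', h.le⟩
  have hp2 : (1 : ℝ) ≤ 2 ^ δ := Real.one_le_rpow (by norm_num) hδ.le
  set A : ℝ := 2 ^ δ * 2 / (1 - β) with hAdef
  have hb : 0 < 1 - β := by linarith
  have hA1 : 1 ≤ A := by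
    rw [hAdef, le_div_iff₀ hb]; linarith
  have hA2 : 2 ^ δ + A * ((2 : ℝ) ^ n * 2) ^ δ * β ≤ A := by
    have : A * (1 - β) = 2 ^ δ * 2 := by rw [hAdef]; field_simp
    nlinarith
  have hA2' : (2 : ℝ≥0∞) ^ δ + ENNReal.ofReal A * (2 ^ n * 2) ^ δ * ENNReal.ofReal β
      ≤ ENNReal.ofReal A := by
    refine le_trans (le_of_eq ?_) (ENNReal.ofReal_le_ofReal hA2)
    rw [ENNReal.ofReal_add (by positivity) (by positivity),
      ENNReal.ofReal_mul (by positivity), ENNReal.ofReal_mul (by positivity),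
      ← ENNReal.ofReal_rpow_of_pos (by positivity), ← ENNReal.ofReal_rpow_of_pos (by positivity),
      ENNReal.ofReal_mul (by positivity), ENNReal.ofReal_pow (by positivity)]
    simp
  have hA1' : 1 ≤ ENNReal.ofReal A := by simpa using hA1
  refine ⟨δ, hδ, A, by linarith, fun c r hr hr1 => ?_⟩
  have hS := stepN f hfin δ hδ _ _ hA1' hA2' hβ
  calc ∫⁻ x in hq c r, f x ^ (1 + δ)
      = ∫⁻ x in hq c r, liminf (fun N => WW f N c r x ^ (1 + δ)) atTop := by
        refine lintegral_congr_ae ?_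
        filter_upwards [WW_tendsto f hf hfin c hr] with x hx
        exact ((ENNReal.continuous_rpow_const.tendsto (f x)).comp hx).liminf_eq.symm
    _ ≤ liminf (fun N => ∫⁻ x in hq c r, WW f N c r x ^ (1 + δ)) atTop :=
        lintegral_liminf_le fun N => (WW_meas f N c r).pow_const _
    _ ≤ liminf (fun _ : ℕ => ENNReal.ofReal A * av f c r ^ δ * ∫⁻ x in hq c r, f x) atTop :=
        liminf_le_liminf (Eventually.of_forall fun N => hS N c r hr hr1)
    _ = _ := by simp

lemma globRH {n : ℕ} (f : (Fin n → ℝ) → ℝ≥0∞) (δ : ℝ) (hδ : 0 < δ) (A : ℝ≥0∞)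
    (h : ∀ (c : Fin n → ℝ) (r : ℝ), 0 < r → r ≤ 1 →
      ∫⁻ x in hq c r, f x ^ (1 + δ) ≤ A * av f c r ^ δ * ∫⁻ x in hq c r, f x)
    (c : Fin n → ℝ) (r : ℝ) (hr : 0 < r) :
    ∫⁻ x in hq c r, f x ^ (1 + δ) ≤
      A * ((ENNReal.ofReal (1 + r)) ^ n * av f c r) ^ δ * ∫⁻ x in hq c r, f x := by
  set N := ⌈r⌉₊ with hN
  have hN0 : 0 < N := Nat.ceil_pos.2 hr
  have hN0' : (0 : ℝ) < N := by exact_mod_cast hN0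
  have hrN : r ≤ N := Nat.le_ceil r
  have hNr : (N : ℝ) ≤ 1 + r := by linarith [Nat.ceil_lt_add_one hr.le]
  set s := r / N with hs
  have hs0 : 0 < s := by positivity
  have hs1 : s ≤ 1 := by rw [hs, div_le_one hN0']; exact hrN
  have e : r = N * s := by rw [hs]; field_simp
  have hav : ∀ k : Fin n → Fin N, av f (subc c s k) s ≤ ENNReal.ofReal (1 + r) ^ n * av f c r := by
    intro k
    have e1 : volume (hq c r) = (N : ℝ≥0∞) ^ n * volume (hq (subc c s k) s) := by
      rw [volume_hq, volume_hq, ← mul_pow]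
      congr 1
      rw [← ENNReal.ofReal_natCast N, ← ENNReal.ofReal_mul hN0'.le, ← e]
    have hsub : hq (subc c s k) s ⊆ hq c r := by
      rw [e, hq_split c hs0]
      exact subset_iUnion (fun k : Fin n → Fin N => hq (subc c s k) s) k
    calc av f (subc c s k) s ≤ (N : ℝ≥0∞) ^ n * av f c r := by
          unfold av
          rw [e1, ← mul_div_assoc, ENNReal.mul_div_mul_left _ _ (by simp [hN0.ne']) (by simp)]
          gcongr
      _ ≤ _ := by
          gcongr
          rw [← ENNReal.ofReal_natCast N]
          exact ENNReal.ofReal_le_ofReal hNr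
  calc ∫⁻ x in hq c r, f x ^ (1 + δ)
      = ∑ k : Fin n → Fin N, ∫⁻ x in hq (subc c s k) s, f x ^ (1 + δ) := by
        rw [← lint_split c hs0, ← e]
    _ ≤ ∑ k : Fin n → Fin N, A * ((ENNReal.ofReal (1 + r)) ^ n * av f c r) ^ δ *
          ∫⁻ x in hq (subc c s k) s, f x := by
        refine Finset.sum_le_sum fun k _ => (h _ _ hs0 hs1).trans ?_
        gcongr
        exact hav k
    _ = _ := by rw [← Finset.mul_sum, ← lint_split c hs0, ← e]

lemma globRH' {n : ℕ} (f : (Fin n → ℝ) → ℝ≥0∞) (δ : ℝ) (hδ : 0 < δ) (A : ℝ≥0∞)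
    (h : ∀ (c : Fin n → ℝ) (r : ℝ), 0 < r → r ≤ 1 →
      ∫⁻ x in hq c r, f x ^ (1 + δ) ≤ A * av f c r ^ δ * ∫⁻ x in hq c r, f x)
    (c : Fin n → ℝ) (r : ℝ) (hr : 0 < r) :
    ((volume (hq c r))⁻¹ * ∫⁻ x in hq c r, f x ^ (1 + δ)) ^ (1 / (1 + δ)) ≤
      A ^ (1 / (1 + δ)) * ((volume (hq c r))⁻¹ * ∫⁻ x in hq c r, f x) *
        ENNReal.ofReal (1 + r) ^ n := by
  have h1 := globRH f δ hδ A h c r hr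
  have hd : 0 < 1 + δ := by linarith
  have hR : (1 : ℝ≥0∞) ≤ ENNReal.ofReal (1 + r) ^ n := by
    refine one_le_pow₀ ?_
    rw [ENNReal.one_le_ofReal]; linarith
  have hav : (volume (hq c r))⁻¹ * ∫⁻ x in hq c r, f x = av f c r := by
    rw [av, ENNReal.div_eq_inv_mul]
  rw [hav]
  set R := ENNReal.ofReal (1 + r) ^ n with hRdef
  calc ((volume (hq c r))⁻¹ * ∫⁻ x in hq c r, f x ^ (1 + δ)) ^ (1 / (1 + δ))
      ≤ ((volume (hq c r))⁻¹ * (A * (R * av f c r) ^ δ * ∫⁻ x in hq c r, f x)) ^ (1 / (1 + δ)) := by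
        gcongr
    _ = (A * (R * av f c r) ^ δ * av f c r) ^ (1 / (1 + δ)) := by
        rw [← hav]; congr 1; ring
    _ ≤ (A * (R * av f c r) ^ δ * (R * av f c r)) ^ (1 / (1 + δ)) := by
        gcongr
        calc av f c r = 1 * av f c r := (one_mul _).symm
          _ ≤ _ := by gcongr
    _ = (A * (R * av f c r) ^ (1 + δ)) ^ (1 / (1 + δ)) := by
        rw [add_comm 1 δ, ENNReal.rpow_add_of_nonneg _ _ hδ.le zero_le_one, ENNReal.rpow_one,
          mul_assoc]
    _ = A ^ (1 / (1 + δ)) * av f c r * R := by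
        rw [ENNReal.mul_rpow_of_nonneg _ _ (by positivity), ← ENNReal.rpow_mul,
          mul_one_div_cancel hd.ne', ENNReal.rpow_one]
        ring

/-- Hölder step, `p > 1`. -/
lemma holderStep {α : Type*} [MeasurableSpace α] (μ : Measure α) (f : α → ℝ≥0∞)
    (hf : AEMeasurable f μ) (hft : ∀ x, f x ≠ ∞) (p : ℝ) (hp : 1 < p) (Q E : Set α)
    (hE : E ⊆ Q) (D : ℝ≥0∞) (hD : D ≠ ∞)
    (hAp : (∫⁻ x in Q, f x ∂μ) ^ (1 / p) * (∫⁻ x in Q, f x ^ (-1 / (p - 1)) ∂μ) ^ (1 - 1 / p) ≤ D) :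
    μ E ^ p * ∫⁻ x in Q, f x ∂μ ≤ D ^ p * ∫⁻ x in E, f x ∂μ := by
  have hp0 : 0 < p := by linarith
  have hpp : 0 < p - 1 := by linarith
  have hq0 : 0 < 1 - 1 / p := by
    rw [sub_pos, div_lt_one hp0]; exact hp
  set a := ∫⁻ x in Q, f x ∂μ with ha
  set b := ∫⁻ x in Q, f x ^ (-1 / (p - 1)) ∂μ with hb
  by_cases ha0 : a = 0
  · rw [ha0]; simp
  have hbt : b ≠ ∞ := by
    intro hbt
    rw [hbt, ENNReal.top_rpow_of_pos hq0, ENNReal.mul_top] at hAp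
    · exact hD (top_le_iff.1 hAp)
    · intro h
      rw [ENNReal.rpow_eq_zero_iff] at h
      rcases h with h | h
      · exact ha0 h.1
      · have : 0 < 1 / p := by positivity
        linarith [h.2]
  have hfm : AEMeasurable f (μ.restrict E) := hf.restrict
  have hbE : ∫⁻ x in E, f x ^ (-1 / (p - 1)) ∂μ ≤ b := lintegral_mono_set hE
  have hpos : ∀ᵐ x ∂(μ.restrict E), f x ≠ 0 := by
    have h1 := ae_lt_top' (hfm.pow_const (-1 / (p - 1))) (hbE.trans_lt hbt.lt_top).ne
    filter_upwards [h1] with x hx h0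
    rw [h0, ENNReal.zero_rpow_of_neg (div_neg_of_neg_of_pos (by norm_num) hpp)] at hx
    exact lt_irrefl _ hx
  have hconj : p.HolderConjugate (p / (p - 1)) := Real.HolderConjugate.conjExponent hp
  have hol := ENNReal.lintegral_mul_le_Lp_mul_Lq (μ.restrict E) hconj
    (hfm.pow_const (1 / p)) (hfm.pow_const (-1 / p))
  have e1 : ∫⁻ x in E, ((fun x => f x ^ (1 / p)) * fun x => f x ^ (-1 / p)) x ∂μ = μ E := by
    rw [← setLIntegral_one]
    refine lintegral_congr_ae ?_
    filter_upwards [hpos] with x hx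
    simp only [Pi.mul_apply]
    rw [← ENNReal.rpow_add _ _ hx (hft x)]
    have : 1 / p + -1 / p = 0 := by ring
    rw [this, ENNReal.rpow_zero]
  have e2 : ∫⁻ x in E, (f x ^ (1 / p)) ^ p ∂μ = ∫⁻ x in E, f x ∂μ := by
    congr 1; funext x
    rw [← ENNReal.rpow_mul, one_div_mul_cancel hp0.ne', ENNReal.rpow_one]
  have e3 : ∫⁻ x in E, (f x ^ (-1 / p)) ^ (p / (p - 1)) ∂μ =
      ∫⁻ x in E, f x ^ (-1 / (p - 1)) ∂μ := by
    congr 1; funext x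
    rw [← ENNReal.rpow_mul]
    congr 1
    field_simp
  have e4 : 1 / (p / (p - 1)) = 1 - 1 / p := by field_simp
  rw [e1, e2, e3, e4] at hol
  have key : μ E * a ^ (1 / p) ≤ D * (∫⁻ x in E, f x ∂μ) ^ (1 / p) := by
    calc μ E * a ^ (1 / p) ≤ ((∫⁻ x in E, f x ∂μ) ^ (1 / p) * b ^ (1 - 1 / p)) * a ^ (1 / p) := by
          gcongr
          exact hol.trans (by gcongr)
      _ = (a ^ (1 / p) * b ^ (1 - 1 / p)) * (∫⁻ x in E, f x ∂μ) ^ (1 / p) := by ring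
      _ ≤ _ := by gcongr
  have := ENNReal.rpow_le_rpow key hp0.le
  rwa [ENNReal.mul_rpow_of_nonneg _ _ hp0.le, ENNReal.mul_rpow_of_nonneg _ _ hp0.le,
    ← ENNReal.rpow_mul, ← ENNReal.rpow_mul, one_div_mul_cancel hp0.ne', ENNReal.rpow_one,
    ENNReal.rpow_one] at this

lemma apStep {n : ℕ} {p θ : ℝ} (hp : 1 ≤ p) (hθ : 0 ≤ θ) {ω : En n → ℝ} (h : ApTheta n p θ ω)
    (hV : ∀ (x : En n) (r : ℝ), 0 < r → volume (cube x r) ≠ 0 ∧ volume (cube x r) ≠ ∞) :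
    ∃ K : ℝ, 1 ≤ K ∧ ∀ (x : En n) (r : ℝ), 0 < r → r ≤ 1 → ∀ E ⊆ cube x r, MeasurableSet E →
      volume E ^ p * ∫⁻ y in cube x r, ENNReal.ofReal (ω y) ≤
        ENNReal.ofReal K * volume (cube x r) ^ p * ∫⁻ y in E, ENNReal.ofReal (ω y) := by
  obtain ⟨-, hloc, C, hC, hap⟩ := h
  have hp0 : 0 < p := by linarith
  refine ⟨max 1 ((C * 2 ^ θ) ^ p), le_max_left _ _, fun x r hr hr1 E hE hEm => ?_⟩
  have hap := hap x r hr
  obtain ⟨hV0, hVt⟩ := hV x r hr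
  set V := volume (cube x r) with hVd
  set T := ENNReal.ofReal ((1 + r) ^ θ) with hT
  have hT0 : T ≠ 0 := by
    rw [hT, Ne, ENNReal.ofReal_eq_zero, not_le]; positivity
  have hTt : T ≠ ∞ := ofReal_ne_top
  have hTV0 : T * V ≠ 0 := mul_ne_zero hT0 hV0
  have hTVt : T * V ≠ ∞ := ENNReal.mul_ne_top hTt hVt
  have hT2 : ENNReal.ofReal C * T ≤ ENNReal.ofReal (C * 2 ^ θ) := by
    rw [hT, ← ENNReal.ofReal_mul hC.le]
    refine ENNReal.ofReal_le_ofReal ?_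
    gcongr
    linarith
  have hK : (ENNReal.ofReal C * (T * V)) ^ p ≤
      ENNReal.ofReal (max 1 ((C * 2 ^ θ) ^ p)) * V ^ p := by
    rw [← mul_assoc, ENNReal.mul_rpow_of_nonneg _ _ hp0.le]
    gcongr
    calc (ENNReal.ofReal C * T) ^ p ≤ ENNReal.ofReal (C * 2 ^ θ) ^ p := by gcongr
      _ = ENNReal.ofReal ((C * 2 ^ θ) ^ p) := ENNReal.ofReal_rpow_of_pos (by positivity)
      _ ≤ _ := ENNReal.ofReal_le_ofReal (le_max_right _ _)
  by_cases h1 : p = 1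
  · rw [if_pos h1] at hap
    rw [h1] at hK ⊢
    simp only [ENNReal.rpow_one] at hK ⊢
    set m := essInf (fun y => ENNReal.ofReal (ω y)) (volume.restrict (cube x r)) with hm
    have hm1 : m * volume E ≤ ∫⁻ y in E, ENNReal.ofReal (ω y) := by
      rw [← setLIntegral_const]
      refine lintegral_mono_ae ?_
      exact ae_mono (Measure.restrict_mono hE le_rfl) (ae_essInf_le (f := fun y => ENNReal.ofReal (ω y)))
    have hap2 : ∫⁻ y in cube x r, ENNReal.ofReal (ω y) ≤ ENNReal.ofReal C * m * (T * V) := by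
      rw [← ENNReal.div_eq_inv_mul] at hap
      exact (ENNReal.div_le_iff hTV0 hTVt).1 hap
    calc volume E * ∫⁻ y in cube x r, ENNReal.ofReal (ω y)
        ≤ volume E * (ENNReal.ofReal C * m * (T * V)) := by gcongr
      _ = (ENNReal.ofReal C * (T * V)) * (m * volume E) := by ring
      _ ≤ _ := by gcongr
  · have hp1 : 1 < p := lt_of_le_of_ne hp (Ne.symm h1)
    rw [if_neg h1] at hap
    have hq0 : 0 ≤ 1 - 1 / p := by
      rw [sub_nonneg, div_le_one hp0]; exact hp
    have hap2 : (∫⁻ y in cube x r, ENNReal.ofReal (ω y)) ^ (1 / p) *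
        (∫⁻ y in cube x r, ENNReal.ofReal (ω y) ^ (-1 / (p - 1))) ^ (1 - 1 / p) ≤
          ENNReal.ofReal C * (T * V) := by
      rw [ENNReal.mul_rpow_of_nonneg _ _ (by positivity), ENNReal.mul_rpow_of_nonneg _ _ hq0] at hap
      rw [← ENNReal.div_le_iff hTV0 hTVt, ENNReal.div_eq_inv_mul]
      refine le_trans (le_of_eq ?_) hap
      have : (T * V)⁻¹ = (T * V)⁻¹ ^ (1 / p) * (T * V)⁻¹ ^ (1 - 1 / p) := by
        rw [← ENNReal.rpow_add _ _ (ENNReal.inv_ne_zero.2 hTVt) (ENNReal.inv_ne_top.2 hTV0)]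
        simp
      conv_lhs => rw [this]
      ring
    refine (holderStep volume (fun y => ENNReal.ofReal (ω y))
      hloc.aestronglyMeasurable.aemeasurable.ennreal_ofReal (fun _ => ofReal_ne_top) p hp1
      (cube x r) E hE _ (ENNReal.mul_ne_top ofReal_ne_top hTVt) hap2).trans ?_
    gcongr

lemma cube_ae {n : ℕ} (x : En n) (r : ℝ) (hr : 0 < r) :
    cube x r =ᵐ[volume] (WithLp.ofLp ⁻¹' hq (fun i => x i - r / 2) r : Set (En n)) := by
  have h1 := hq_ae_ball (fun i => x i - r / 2) hr
  have h2 : cube x r = (WithLp.ofLp ⁻¹' Metric.closedBall (fun i => x i - r / 2 + r / 2) (r / 2) :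
      Set (En n)) := by
    ext y
    simp only [cube, mem_ofPred_eq, mem_preimage, mem_closedBall_iff_norm]
    rw [pi_norm_le_iff_of_nonneg (half_pos hr).le]
    simp [Real.norm_eq_abs]
  rw [h2]
  exact ((PiLp.volume_preserving_ofLp (Fin n)).quasiMeasurePreserving.preimage_ae_eq h1).symm

lemma cube_lint {n : ℕ} (x : En n) (r : ℝ) (hr : 0 < r) (g : (Fin n → ℝ) → ℝ≥0∞) :
    ∫⁻ y in cube x r, g (WithLp.ofLp y) = ∫⁻ z in hq (fun i => x i - r / 2) r, g z := by
  rw [setLIntegral_congr (cube_ae x r hr)]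
  exact (PiLp.volume_preserving_ofLp (Fin n)).setLIntegral_comp_preimage_emb
    (MeasurableEquiv.toLp 2 (Fin n → ℝ)).symm.measurableEmbedding g _

lemma cube_vol {n : ℕ} (x : En n) (r : ℝ) (hr : 0 < r) :
    volume (cube x r) = volume (hq (fun i => x i - r / 2) r) := by
  rw [measure_congr (cube_ae x r hr)]
  exact (PiLp.volume_preserving_ofLp (Fin n)).measure_preimage
    (measurableSet_hq _ _).nullMeasurableSet

lemma hq_sub_cube {n : ℕ} (c : Fin n → ℝ) (r : ℝ) :
    (WithLp.ofLp ⁻¹' hq c r : Set (En n)) ⊆ cube (WithLp.toLp 2 fun i => c i + r / 2) r := by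
  intro y hy i
  have := mem_hq.1 hy i
  simp only [abs_le]
  constructor <;> linarith

lemma mainRH {n : ℕ} {p : ℝ} (hp : 1 ≤ p) {ω : En n → ℝ}
    (hω : ∃ θ ≥ 0, ApTheta n p θ ω) :
    ∃ δ : ℝ, 0 < δ ∧ ∃ C : ℝ, 0 < C ∧ ∀ (x : En n) (r : ℝ), 0 < r →
      ((volume (cube x r))⁻¹ *
          ∫⁻ y in cube x r, ENNReal.ofReal (ω y) ^ ((1 : ℝ) + δ)) ^ (1 / (1 + δ)) ≤
        ENNReal.ofReal C *
          ((volume (cube x r))⁻¹ * ∫⁻ y in cube x r, ENNReal.ofReal (ω y)) *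
          ENNReal.ofReal ((1 + r) ^ n) := by
  obtain ⟨θ, hθ, hA⟩ := hω
  have hp0 : 0 < p := by linarith
  have hmp := PiLp.volume_preserving_ofLp (Fin n)
  have hV : ∀ (x : En n) (r : ℝ), 0 < r → volume (cube x r) ≠ 0 ∧ volume (cube x r) ≠ ∞ :=
    fun x r hr => by
      rw [cube_vol x r hr]
      exact ⟨volume_hq_ne_zero _ hr, volume_hq_ne_top _ _⟩
  obtain ⟨K, hK1, hK⟩ := apStep hp hθ hA hV
  have hloc : LocallyIntegrable ω volume := hA.2.1
  let f0 : (Fin n → ℝ) → ℝ≥0∞ := fun z => ENNReal.ofReal (ω (WithLp.toLp 2 z))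
  have hf0 : AEMeasurable f0 volume := by
    have h1 : AEMeasurable ω volume := hloc.aestronglyMeasurable.aemeasurable
    exact (h1.comp_quasiMeasurePreserving
      (PiLp.volume_preserving_toLp (Fin n)).quasiMeasurePreserving).ennreal_ofReal
  let f := hf0.mk f0
  have hfm : Measurable f := hf0.measurable_mk
  have hfe : f0 =ᵐ[volume] f := hf0.ae_eq_mk
  have hfs : ∀ (s : Set (Fin n → ℝ)) (G : ℝ≥0∞ → ℝ≥0∞),
      ∫⁻ z in s, G (f0 z) = ∫⁻ z in s, G (f z) := fun s G =>
    lintegral_congr_ae (ae_restrict_of_ae (hfe.mono fun z hz => by simp only [hz]))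
  have hcube : ∀ (x : En n) (r : ℝ), 0 < r → ∀ G : ℝ≥0∞ → ℝ≥0∞,
      ∫⁻ y in cube x r, G (ENNReal.ofReal (ω y)) =
        ∫⁻ z in hq (fun i => x i - r / 2) r, G (f z) := fun x r hr G => by
    rw [← hfs, ← cube_lint x r hr]
  have hfin : ∀ c r, ∫⁻ z in hq c r, f z ≠ ∞ := by
    intro c r
    have hb : hq c r ⊆ Metric.closedBall c (max r 0) := by
      intro y hy
      rw [mem_closedBall_iff_norm, pi_norm_le_iff_of_nonneg (le_max_right _ _)]
      intro i
      have := mem_hq.1 hy i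
      rw [Pi.sub_apply, Real.norm_eq_abs, abs_le]
      constructor <;> linarith [le_max_left r 0, le_max_right r 0]
    have hcomp : IsCompact (WithLp.ofLp ⁻¹' Metric.closedBall c (max r 0) : Set (En n)) :=
      (EuclideanSpace.equiv (Fin n) ℝ).toHomeomorph.isClosedEmbedding.isCompact_preimage
        (isCompact_closedBall _ _)
    have h1 := (hloc.integrableOn_isCompact hcomp).mono_set (preimage_mono hb)
    have h2 : ∫⁻ y in (WithLp.ofLp ⁻¹' hq c r : Set (En n)), f0 (WithLp.ofLp y) = ∫⁻ z in hq c r, f0 z :=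
      hmp.setLIntegral_comp_preimage_emb
        (MeasurableEquiv.toLp 2 (Fin n → ℝ)).symm.measurableEmbedding f0 _
    have h3 := hfs (hq c r) id
    simp only [id] at h3
    rw [← h3, ← h2]
    have h4 := h1.2
    refine (lt_of_le_of_lt ?_ h4).ne
    refine lintegral_mono fun y => ?_
    rw [Real.enorm_eq_ofReal_abs]
    exact ENNReal.ofReal_le_ofReal (le_abs_self _)
  set L : ℝ := 2 ^ p * K with hL
  have h2p : (1 : ℝ) ≤ 2 ^ p := Real.one_le_rpow (by norm_num) hp0.le
  have hL1 : 1 ≤ L := by nlinarith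
  have hL0 : 0 < L := by linarith
  obtain ⟨δ, hδ, A, hA0, hRH⟩ := coreRH f hfm hfin (1 - 1 / L)
    (by rw [sub_nonneg, div_le_one hL0]; exact hL1)
    (by have : 0 < 1 / L := by positivity
        linarith) (by
    intro c r hr hr1 E hE hEm hE2
    set F := hq c r \ E with hF
    have hFm : MeasurableSet F := (measurableSet_hq c r).diff hEm
    have hV0 := volume_hq_ne_zero c hr
    have hVt := volume_hq_ne_top c r
    have hsum : (∫⁻ x in E, f x) + ∫⁻ x in F, f x = ∫⁻ x in hq c r, f x := by
      rw [← lintegral_union hFm disjoint_sdiff_right, union_sdiff_cancel hE]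
    have hvs : volume E + volume F = volume (hq c r) := by
      rw [← measure_union disjoint_sdiff_right hFm, union_sdiff_cancel hE]
    have hEt : volume E ≠ ∞ := ((measure_mono hE).trans_lt hVt.lt_top).ne
    have hVF : volume (hq c r) ≤ 2 * volume F := by
      have h1 : volume E + volume E ≤ volume E + volume F := by rw [hvs, ← two_mul]; exact hE2
      have h2 := (ENNReal.add_le_add_iff_left hEt).1 h1
      rw [← hvs, two_mul]
      gcongr
    have hx : (fun i => (WithLp.toLp 2 (fun i => c i + r / 2) : En n) i - r / 2) = c := by
      funext i; simp
    have h1 := hK (WithLp.toLp 2 fun i => c i + r / 2) r hr hr1 (WithLp.ofLp ⁻¹' F)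
      ((preimage_mono sdiff_subset).trans (hq_sub_cube c r)) (hmp.measurable hFm)
    have e1 := hcube (WithLp.toLp 2 fun i => c i + r / 2) r hr id
    have e2 : ∫⁻ y in (WithLp.ofLp ⁻¹' F : Set (En n)), f0 (WithLp.ofLp y) = ∫⁻ z in F, f0 z :=
      hmp.setLIntegral_comp_preimage_emb
        (MeasurableEquiv.toLp 2 (Fin n → ℝ)).symm.measurableEmbedding f0 _
    have e2' : ∫⁻ y in (WithLp.ofLp ⁻¹' F : Set (En n)), ENNReal.ofReal (ω y) = ∫⁻ z in F, f z :=
      e2.trans (hfs F id)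
    simp only [id] at e1
    rw [cube_vol _ _ hr, e1, e2', hx, hmp.measure_preimage hFm.nullMeasurableSet] at h1
    have h2 : volume (hq c r) ^ p * ∫⁻ z in hq c r, f z ≤
        volume (hq c r) ^ p * (ENNReal.ofReal L * ∫⁻ z in F, f z) := by
      calc volume (hq c r) ^ p * ∫⁻ z in hq c r, f z
          ≤ (2 * volume F) ^ p * ∫⁻ z in hq c r, f z := by gcongr
        _ = 2 ^ p * (volume F ^ p * ∫⁻ z in hq c r, f z) := by
            rw [ENNReal.mul_rpow_of_nonneg _ _ hp0.le, mul_assoc]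
        _ ≤ 2 ^ p * (ENNReal.ofReal K * volume (hq c r) ^ p * ∫⁻ z in F, f z) := by gcongr
        _ = _ := by
            rw [hL, ENNReal.ofReal_mul (by positivity), ← ENNReal.ofReal_rpow_of_pos two_pos]
            simp only [ENNReal.ofReal_ofNat]
            ring
    have h3 : ∫⁻ z in hq c r, f z ≤ ENNReal.ofReal L * ∫⁻ z in F, f z := by
      refine (ENNReal.mul_le_mul_iff_right ?_ ?_).1 h2
      · simp [ENNReal.rpow_eq_zero_iff, hV0, hVt]
      · simp [ENNReal.rpow_eq_top_iff, hV0, hVt]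
    have hQt := hfin c r
    have hFt : ∫⁻ z in F, f z ≠ ∞ := by
      refine (lt_of_le_of_lt ?_ hQt.lt_top).ne
      rw [← hsum]; exact le_add_self
    have hEt : ∫⁻ z in E, f z ≠ ∞ := by
      refine (lt_of_le_of_lt ?_ hQt.lt_top).ne
      rw [← hsum]; exact le_self_add
    have s1 := congrArg ENNReal.toReal hsum
    rw [ENNReal.toReal_add hEt hFt] at s1
    have s2 := ENNReal.toReal_mono (ENNReal.mul_ne_top ofReal_ne_top hFt) h3
    rw [ENNReal.toReal_mul, ENNReal.toReal_ofReal hL0.le] at s2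
    rw [← ENNReal.ofReal_toReal hEt, ← ENNReal.ofReal_toReal hQt,
      ← ENNReal.ofReal_mul (by rw [sub_nonneg, div_le_one hL0]; exact hL1)]
    refine ENNReal.ofReal_le_ofReal ?_
    have s3 : (∫⁻ z in hq c r, f z).toReal / L ≤ (∫⁻ z in F, f z).toReal := by
      rw [div_le_iff₀ hL0]; linarith
    have s4 : (1 - 1 / L) * (∫⁻ z in hq c r, f z).toReal =
      (∫⁻ z in hq c r, f z).toReal - (∫⁻ z in hq c r, f z).toReal / L := by ring
    rw [s4]; linarith)
  refine ⟨δ, hδ, A ^ (1 / (1 + δ)), by positivity, fun x r hr => ?_⟩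
  have h1 := globRH' f δ hδ _ hRH (fun i => x i - r / 2) r hr
  have e1 := hcube x r hr id
  have e2 := hcube x r hr (fun t => t ^ (1 + δ))
  simp only [id] at e1 e2
  rw [cube_vol x r hr, e1, e2, ← ENNReal.ofReal_rpow_of_pos hA0,
    ENNReal.ofReal_pow (by linarith)]
  exact h1

/-- Lemma 2.1(iii): a reverse Hölder type inequality with the factor `(1+r)^l`
for weights in `A_p^∞(φ)`. -/
theorem stmt9 (n : ℕ) (hn : 0 < n) (p : ℝ) (hp : 1 ≤ p) (ω : En n → ℝ)
    (hω : ∃ θ ≥ 0, ApTheta n p θ ω) :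
    ∃ l > 0, ∃ δ > 0, ∃ C > 0, ∀ (x : En n) (r : ℝ), 0 < r →
      ((volume (cube x r))⁻¹ *
          ∫⁻ y in cube x r, ENNReal.ofReal (ω y) ^ ((1 : ℝ) + δ)) ^ (1 / (1 + δ)) ≤
        ENNReal.ofReal C *
          ((volume (cube x r))⁻¹ * ∫⁻ y in cube x r, ENNReal.ofReal (ω y)) *
          ENNReal.ofReal ((1 + r) ^ l) := by
  obtain ⟨δ, hδ, C, hC, h⟩ := mainRH hp hω
  exact ⟨n, by exact_mod_cast hn, δ, hδ, C, hC, fun x r hr => by simpa using h x r hr⟩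


end
end
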